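/- arXiv:0805.4654 — 3 statements merged into one kernel-verified Lean document; each statement's English description precedes it below -/
import Mathlib

section
/- Among the 8! = 40,320 permutations of the 8-element set W_2^3, exactly 4!·2^4 = 384 satisfy the diagonal condition, and exactly 48 satisfy both the diagonal condition and the annihilation condition. -/
/-- For a permutation `σ` of words of length `k+1` over the alphabet `Fin n`, and a letter `i`,
`fword σ i α` is the word `β` of length `k` such that `σ (β.m) = i.α` for some letter `m`,
i.e. the first `k` letters of `σ⁻¹ (i.α)`.  (The map `f_i^σ` of the paper.) -/
def fword {n k : ℕ} (σ : Equiv.Perm (Fin (k + 1) → Fin n)) (i : Fin n)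
    (α : Fin k → Fin n) : Fin k → Fin n :=
  Fin.init (σ.symm (Fin.cons i α))

/-- The sets `Σ_m` associated to a family of maps `f_i : X → X`. -/
def SigmaSet {X : Type*} {n : ℕ} (f : Fin n → X → X) : ℕ → Set (X × X)
  | 0 => {p | p.1 = p.2}
  | m + 1 => SigmaSet f m ∪ {p | ∀ i, (f i p.1, f i p.2) ∈ SigmaSet f m}

/-- The diagonal condition: `⋃ m, Σ_m = X × X` for the family `f_i^σ`. -/
def diagCond {n k : ℕ} (σ : Equiv.Perm (Fin (k + 1) → Fin n)) : Prop :=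
  (⋃ m, SigmaSet (fword σ) m) = Set.univ

/-- The set `𝒲`: off-diagonal pairs of words of length `k`, together with a point `†` (`none`). -/
def OffDiag (n k : ℕ) := Option {q : (Fin k → Fin n) × (Fin k → Fin n) // q.1 ≠ q.2}

/-- The map `f_{ij}^σ` on `𝒲`: it sends `(α,β)` to `(γ,δ)` if `σ(γm) = iα` and `σ(δm) = jβ`
for some letter `m`, and to `†` otherwise; `†` is fixed. -/
def fpair {n k : ℕ} (σ : Equiv.Perm (Fin (k + 1) → Fin n)) (i j : Fin n) :
    OffDiag n k → OffDiag n k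
  | none => none
  | some ⟨(α, β), _⟩ =>
      if h : (σ.symm (Fin.cons i α)) (Fin.last k) = (σ.symm (Fin.cons j β)) (Fin.last k) ∧
          Fin.init (σ.symm (Fin.cons i α)) ≠ Fin.init (σ.symm (Fin.cons j β)) then
        some ⟨(Fin.init (σ.symm (Fin.cons i α)), Fin.init (σ.symm (Fin.cons j β))), h.2⟩
      else none

/-- The sets `Ψ_m` associated to a family of maps `g_j : Y → Y` and a point `†`. -/
def PsiSet {Y ι : Type*} (dag : Y) (g : ι → Y → Y) : ℕ → Set Y
  | 0 => {dag}
  | m + 1 => {dag} ∪ {y | ∀ j, g j y ∈ PsiSet dag g m}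

/-- The annihilation condition: `⋃ m, Ψ_m = 𝒲` for the family `f_{ij}^σ`. -/
def annCond {n k : ℕ} (σ : Equiv.Perm (Fin (k + 1) → Fin n)) : Prop :=
  (⋃ m, PsiSet (none : OffDiag n k) (fun ij : Fin n × Fin n => fpair σ ij.1 ij.2) m) = Set.univ

namespace Cuntz

def mem (a : ℕ) (l : List ℕ) : Bool :=
  List.rec false (fun b _ ih => cond (Nat.beq a b) true ih) l

def nth (l : List ℕ) : ℕ → ℕ :=
  List.rec (fun _ => 0) (fun a _ ih n => Nat.rec a (fun m _ => ih m) n) l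

def cnt (a : ℕ) (l : List ℕ) : ℕ :=
  List.rec 0 (fun b _ ih => cond (Nat.beq a b) (Nat.succ ih) ih) l

def filt (p : ℕ → Bool) (l : List ℕ) : List ℕ :=
  List.rec [] (fun b _ ih => cond (p b) (b :: ih) ih) l

def codes : List ℕ := [0, 1, 2, 3, 4, 5, 6, 7, 8, 9, 10, 11, 12, 13, 14, 15]

def start : List ℕ := [0, 5, 10, 15]

def next (C : List ℕ → ℕ → Bool) (S : List ℕ) : List ℕ :=
  filt (fun c => cond (mem c S) true (C S c)) codes

/-- iteration of `next` with early termination -/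
def iter (C : List ℕ → ℕ → Bool) : ℕ → List ℕ → List ℕ
  | 0, S => S
  | k + 1, S => cond (Nat.beq (next C S).length S.length) S (iter C k (next C S))

def total (C : List ℕ → ℕ → Bool) : Bool := Nat.beq (iter C 16 start).length 16

/-- `pairMem S x y`: the code of `(x, y)` belongs to `S` (evaluation of the code is forced). -/
def pairMem (S : List ℕ) (x y : ℕ) : Bool :=
  Nat.rec (mem 0 S) (fun m _ => mem (Nat.succ m) S) (Nat.add (Nat.mul 4 x) y)

def dCell (g : List ℕ) (S : List ℕ) (a b : ℕ) : Bool :=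
  cond (pairMem S (nth g a) (nth g b)) (pairMem S (nth g (Nat.add 4 a)) (nth g (Nat.add 4 b))) false

def dC (g : List ℕ) (S : List ℕ) (c : ℕ) : Bool := dCell g S (Nat.div c 4) (Nat.mod c 4)

def aOne (S : List ℕ) (x y : ℕ) : Bool :=
  cond (Nat.beq (Nat.mod x 2) (Nat.mod y 2)) (pairMem S (Nat.div x 2) (Nat.div y 2)) true

def aCell (l : List ℕ) (S : List ℕ) (a b : ℕ) : Bool :=
  cond (aOne S (nth l a) (nth l b))
  (cond (aOne S (nth l a) (nth l (Nat.add 4 b)))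
  (cond (aOne S (nth l (Nat.add 4 a)) (nth l b))
  (aOne S (nth l (Nat.add 4 a)) (nth l (Nat.add 4 b))) false) false) false

def aC (l : List ℕ) (S : List ℕ) (c : ℕ) : Bool := aCell l S (Nat.div c 4) (Nat.mod c 4)

def go : ℕ → List ℕ → List (List ℕ)
  | 0, l => cond (total (dC l)) [l] []
  | k + 1, l => [0, 1, 2, 3].flatMap fun a => cond (Nat.ble (cnt a l) 1) (go k (a :: l)) []

def lifts : List ℕ → List (List ℕ)
  | [] => [[]]
  | b :: g => (lifts g).flatMap fun l =>
      (cond (mem (2 * b) l) [] [2 * b :: l]) ++ (cond (mem (2 * b + 1) l) [] [(2 * b + 1) :: l])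

def G24 : List (List ℕ) :=
  [[3, 3, 2, 2, 1, 1, 0, 0], [2, 2, 3, 3, 1, 1, 0, 0], [3, 1, 3, 1, 2, 0, 2, 0], [1, 3, 1, 3, 2, 0, 2, 0],
  [1, 2, 2, 1, 0, 3, 3, 0], [2, 1, 1, 2, 0, 3, 3, 0], [3, 3, 2, 2, 0, 0, 1, 1], [2, 2, 3, 3, 0, 0, 1, 1],
  [0, 3, 3, 0, 1, 2, 2, 1], [3, 0, 0, 3, 1, 2, 2, 1], [2, 0, 2, 0, 3, 1, 3, 1], [0, 2, 0, 2, 3, 1, 3, 1],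
  [3, 1, 3, 1, 0, 2, 0, 2], [1, 3, 1, 3, 0, 2, 0, 2], [0, 3, 3, 0, 2, 1, 1, 2], [3, 0, 0, 3, 2, 1, 1, 2],
  [1, 1, 0, 0, 3, 3, 2, 2], [0, 0, 1, 1, 3, 3, 2, 2], [1, 2, 2, 1, 3, 0, 0, 3], [2, 1, 1, 2, 3, 0, 0, 3],
  [2, 0, 2, 0, 1, 3, 1, 3], [0, 2, 0, 2, 1, 3, 1, 3], [1, 1, 0, 0, 2, 2, 3, 3], [0, 0, 1, 1, 2, 2, 3, 3]]

def T : List (List ℕ) := G24.flatMap lifts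

theorem go_eq : go 8 [] = G24 := by decide +kernel

theorem T_length : T.length = 384 := by decide +kernel

theorem T_ann_length : (T.filter (fun l => total (aC l))).length = 48 := by decide +kernel

theorem G24_nodup : G24.Nodup := by decide +kernel

theorem G24_sound : ∀ g ∈ G24, total (dC g) = true ∧ g.length = 8 ∧ ∀ a ∈ g, a < 4 := by
  decide +kernel

/-! ### Basic facts about the list functions -/

theorem mem_iff (a : ℕ) (l : List ℕ) : mem a l = true ↔ a ∈ l := by
  induction l with
  | nil => simp [mem]
  | cons b t ih =>
    have h : mem a (b :: t) = cond (Nat.beq a b) true (mem a t) := rfl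
    rw [h, List.mem_cons, ← ih]
    cases hb : Nat.beq a b with
    | true => simp [Nat.eq_of_beq_eq_true hb]
    | false => simp [Nat.ne_of_beq_eq_false hb]

theorem nth_eq (l : List ℕ) (n : ℕ) : nth l n = l.getD n 0 := by
  induction l generalizing n with
  | nil => simp [nth]
  | cons b t ih =>
    cases n with
    | zero => simp [nth]
    | succ m =>
      have h : nth (b :: t) (m + 1) = nth t m := rfl
      rw [h, ih]; simp

theorem cnt_eq (a : ℕ) (l : List ℕ) : cnt a l = l.count a := by
  induction l with
  | nil => simp [cnt]
  | cons b t ih =>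
    have h : cnt a (b :: t) = cond (Nat.beq a b) (Nat.succ (cnt a t)) (cnt a t) := rfl
    rw [h, ih, List.count_cons]
    cases hb : Nat.beq a b with
    | true => simp [Nat.eq_of_beq_eq_true hb]
    | false => simp [Ne.symm (Nat.ne_of_beq_eq_false hb)]

theorem filt_eq (p : ℕ → Bool) (l : List ℕ) : filt p l = l.filter p := by
  induction l with
  | nil => simp [filt]
  | cons b t ih =>
    have h : filt p (b :: t) = cond (p b) (b :: filt p t) (filt p t) := rfl
    rw [h, ih, List.filter_cons]
    cases p b <;> simp

theorem pairMem_iff (S : List ℕ) (x y : ℕ) : pairMem S x y = true ↔ 4 * x + y ∈ S := by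
  rw [← mem_iff]
  have h : pairMem S x y
    = Nat.rec (mem 0 S) (fun m _ => mem (Nat.succ m) S) (4 * x + y) := rfl
  rw [h]
  cases (4 * x + y) <;> rfl

theorem mem_next (C : List ℕ → ℕ → Bool) (S : List ℕ) (c : ℕ) :
    c ∈ next C S ↔ c ∈ codes ∧ (c ∈ S ∨ C S c = true) := by
  rw [next, filt_eq, List.mem_filter, ← mem_iff c S]
  cases mem c S <;> simp

/-! ### Stabilisation -/

def Good (S : List ℕ) : Prop := S = codes.filter (fun c => mem c S)

theorem good_filter (p : ℕ → Bool) : Good (codes.filter p) := by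
  unfold Good
  apply List.filter_congr
  intro c hc
  rw [Bool.eq_iff_iff, mem_iff, List.mem_filter]
  simp [hc]

theorem good_next (C : List ℕ → ℕ → Bool) (S : List ℕ) : Good (next C S) := by
  rw [next, filt_eq]; exact good_filter _

theorem good_start : Good start := by unfold Good; decide

theorem good_iterate (C : List ℕ → ℕ → Bool) {S : List ℕ} (h : Good S) (m : ℕ) :
    Good ((next C)^[m] S) := by
  cases m with
  | zero => exact h
  | succ m => rw [Function.iterate_succ_apply']; exact good_next _ _

theorem sublist_next (C : List ℕ → ℕ → Bool) {S : List ℕ} (h : Good S) :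
    S.Sublist (next C S) := by
  have h2 : S.Sublist (codes.filter (fun c => cond (mem c S) true (C S c))) := by
    conv_lhs => rw [h]
    apply List.monotone_filter_right
    intro c hc
    rw [hc]; rfl
  rw [next, filt_eq]; exact h2

theorem iter_eq (C : List ℕ → ℕ → Bool) (k : ℕ) (S : List ℕ) (h : Good S) :
    iter C k S = (next C)^[k] S := by
  induction k generalizing S with
  | zero => rfl
  | succ k ih =>
    rw [iter]
    cases hb : Nat.beq (next C S).length S.length with
    | true =>
      have e := (sublist_next C h).eq_of_length (Nat.eq_of_beq_eq_true hb).symm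
      simp only [cond_true]
      exact (Function.iterate_fixed e.symm _).symm
    | false =>
      simp only [cond_false]
      rw [ih _ (good_next C S), Function.iterate_succ_apply]

theorem sublist_iterate (C : List ℕ → ℕ → Bool) {m n : ℕ} (h : m ≤ n) :
    ((next C)^[m] start).Sublist ((next C)^[n] start) := by
  induction n, h using Nat.le_induction with
  | base => exact List.Sublist.refl _
  | succ n _ ih =>
    rw [Function.iterate_succ_apply']
    exact ih.trans (sublist_next C (good_iterate C good_start n))

theorem iterate_stable (C : List ℕ → ℕ → Bool) (m : ℕ) :
    ((next C)^[m] start).Sublist ((next C)^[16] start) := by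
  rcases le_total m 16 with h | h
  · exact sublist_iterate C h
  · have hlen : ((next C)^[m] start).length = ((next C)^[16] start).length := by
      apply Nat.stabilises_of_monotone (f := fun m => ((next C)^[m] start).length) (b := 16)
      · intro a b hab
        exact (sublist_iterate C hab).length_le
      · intro a
        have := good_iterate C good_start a
        show ((next C)^[a] start).length ≤ 16
        rw [this]
        exact List.length_filter_le _ _
      · intro a ha
        have e := (sublist_iterate C (Nat.le_succ a)).eq_of_length ha
        show ((next C)^[a + 1] start).length = ((next C)^[a + 2] start).length
        have e' := congrArg (next C) e
        rw [← Function.iterate_succ_apply' (next C), ← Function.iterate_succ_apply' (next C)] at e'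
        exact congrArg List.length e'
      · exact h
    rw [(sublist_iterate C h).eq_of_length hlen.symm]

theorem total_iff (C : List ℕ → ℕ → Bool) :
    total C = true ↔ ∀ c ∈ codes, ∃ m, c ∈ (next C)^[m] start := by
  rw [total, iter_eq C 16 start good_start]
  have hsub : ((next C)^[16] start).Sublist codes := by
    have := good_iterate C good_start 16
    rw [this]
    exact List.filter_sublist
  constructor
  · intro h c hc
    refine ⟨16, ?_⟩
    rw [hsub.eq_of_length (Nat.eq_of_beq_eq_true h)]
    exact hc
  · intro h
    have e : (next C)^[16] start = codes := by
      rw [show (next C)^[16] start = _ from good_iterate C good_start 16]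
      apply List.filter_eq_self.2
      intro c hc
      obtain ⟨m, hm⟩ := h c hc
      rw [mem_iff]
      exact (iterate_stable C m).subset hm
    rw [e]; rfl

/-! ### Completeness of the search -/

theorem go_complete (k : ℕ) (p l : List ℕ) (hp : p.length = k) (h4 : ∀ a ∈ p, a < 4)
    (hc : ∀ a, (p ++ l).count a ≤ 2) (ht : total (dC (p ++ l)) = true) : p ++ l ∈ go k l := by
  induction k generalizing p l with
  | zero =>
    obtain rfl := List.length_eq_zero_iff.1 hp
    rw [List.nil_append] at ht ⊢
    simp [go, ht]
  | succ k ih =>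
    rcases List.eq_nil_or_concat p with rfl | ⟨q, a, rfl⟩
    · simp at hp
    · simp only [List.concat_eq_append, List.append_assoc, List.singleton_append,
        List.length_append, List.length_singleton] at *
      have ha : a < 4 := h4 a (by simp)
      have h1 := ih q (a :: l) (by omega) (fun b hb => h4 b (by simp [hb])) hc ht
      rw [go, List.mem_flatMap]
      refine ⟨a, ?_, ?_⟩
      · interval_cases a <;> simp
      · have h2 : Nat.ble (cnt a l) 1 = true := by
          rw [Nat.ble_eq, cnt_eq]
          have := hc a
          rw [List.count_append, List.count_cons_self] at this
          omega
        rw [h2]; exact h1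

theorem mem_lifts (g x : List ℕ) : x ∈ lifts g ↔ x.Nodup ∧ x.map (· / 2) = g := by
  induction g generalizing x with
  | nil =>
    simp only [lifts, List.mem_singleton, List.map_eq_nil_iff]
    constructor
    · rintro rfl; simp
    · exact fun h => h.2
  | cons b g ih =>
    have key : ∀ (a : ℕ) (l : List ℕ),
        x ∈ cond (mem a l) [] [a :: l] ↔ a ∉ l ∧ x = a :: l := by
      intro a l
      rw [← mem_iff]
      cases mem a l <;> simp
    simp only [lifts, List.mem_flatMap, List.mem_append, key]
    constructor
    · rintro ⟨l, hl, ⟨h1, rfl⟩ | ⟨h1, rfl⟩⟩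
      · obtain ⟨h2, h3⟩ := (ih l).1 hl
        refine ⟨List.nodup_cons.2 ⟨h1, h2⟩, ?_⟩
        rw [List.map_cons, h3]
        congr 1
        omega
      · obtain ⟨h2, h3⟩ := (ih l).1 hl
        refine ⟨List.nodup_cons.2 ⟨h1, h2⟩, ?_⟩
        rw [List.map_cons, h3]
        congr 1
        omega
    · rintro ⟨h1, h2⟩
      cases x with
      | nil => simp at h2
      | cons a l =>
        rw [List.map_cons, List.cons.injEq] at h2
        rw [List.nodup_cons] at h1
        refine ⟨l, (ih l).2 ⟨h1.2, h2.2⟩, ?_⟩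
        have : a = 2 * b ∨ a = 2 * b + 1 := by omega
        rcases this with rfl | rfl
        · exact Or.inl ⟨h1.1, rfl⟩
        · exact Or.inr ⟨h1.1, rfl⟩

theorem lifts_nodup (g : List ℕ) : (lifts g).Nodup := by
  induction g with
  | nil => simp [lifts]
  | cons b g ih =>
    rw [lifts, List.nodup_flatMap]
    constructor
    · intro l _
      cases mem (2 * b) l <;> cases mem (2 * b + 1) l <;> simp
    · refine ih.imp ?_
      intro l l' hne x hx hx'
      apply hne
      revert hx hx'
      cases mem (2 * b) l <;> cases mem (2 * b + 1) l <;> cases mem (2 * b) l' <;>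
        cases mem (2 * b + 1) l' <;> simp <;> grind

theorem T_nodup : T.Nodup := by
  rw [T, List.nodup_flatMap]
  refine ⟨fun g _ => lifts_nodup g, G24_nodup.imp ?_⟩
  intro g g' hne x hx hx'
  rw [mem_lifts] at hx hx'
  exact hne (hx.2.symm.trans hx'.2)

theorem count_half (x : List ℕ) (hx : x.Nodup) (a : ℕ) : (x.map (· / 2)).count a ≤ 2 := by
  have h1 : (x.map (· / 2)).count a = (x.filter (fun y => y / 2 == a)).length := by
    rw [List.count, List.countP_map, List.countP_eq_length_filter]; rfl
  rw [h1]
  have h2 : (x.filter (fun y => y / 2 == a)).Subperm [2 * a, 2 * a + 1] := by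
    apply List.Nodup.subperm (hx.filter _)
    intro y hy
    rw [List.mem_filter] at hy
    have := hy.2
    simp at this ⊢
    omega
  exact h2.length_le

theorem mem_T (x : List ℕ) : x ∈ T ↔
    x.Nodup ∧ x.length = 8 ∧ (∀ a ∈ x, a < 8) ∧ total (dC (x.map (· / 2))) = true := by
  rw [T, List.mem_flatMap]
  constructor
  · rintro ⟨g, hg, hx⟩
    obtain ⟨h1, rfl⟩ := (mem_lifts g x).1 hx
    obtain ⟨h2, h3, h4⟩ := G24_sound _ hg
    refine ⟨h1, by simpa using h3, ?_, h2⟩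
    intro a ha
    have := h4 (a / 2) (List.mem_map.2 ⟨a, ha, rfl⟩)
    omega
  · rintro ⟨h1, h2, h3, h4⟩
    refine ⟨x.map (· / 2), ?_, (mem_lifts _ _).2 ⟨h1, rfl⟩⟩
    rw [← go_eq]
    have := go_complete 8 (x.map (· / 2)) [] (by simpa using h2) ?_ ?_ ?_
    · simpa using this
    · intro a ha
      obtain ⟨y, hy, rfl⟩ := List.mem_map.1 ha
      have := h3 y hy
      show y / 2 < 4
      omega
    · intro a
      rw [List.append_nil]
      exact count_half x h1 a
    · rw [List.append_nil]; exact h4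

/-! ### Coding of words -/

def E2 : (Fin 2 → Fin 2) ≃ Fin 4 where
  toFun w := ⟨2 * (w 0).val + (w 1).val, by omega⟩
  invFun x := ![⟨x.val / 2, by omega⟩, ⟨x.val % 2, by omega⟩]
  left_inv := by decide
  right_inv := by decide

def E3 : (Fin (2 + 1) → Fin 2) ≃ Fin 8 where
  toFun w := ⟨4 * (w 0).val + 2 * (w 1).val + (w 2).val, by omega⟩
  invFun x := ![⟨x.val / 4, by omega⟩, ⟨x.val / 2 % 2, by omega⟩, ⟨x.val % 2, by omega⟩]
  left_inv := by decide
  right_inv := by decide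

theorem E2_init : ∀ w : Fin (2 + 1) → Fin 2, (E2 (Fin.init w)).val = (E3 w).val / 2 := by decide

theorem E3_last : ∀ w : Fin (2 + 1) → Fin 2, (w (Fin.last 2)).val = (E3 w).val % 2 := by decide

theorem E3_cons : ∀ (i : Fin 2) (α : Fin 2 → Fin 2),
    (E3 (Fin.cons i α)).val = 4 * i.val + (E2 α).val := by decide

def L (σ : Equiv.Perm (Fin (2 + 1) → Fin 2)) : List ℕ :=
  List.ofFn (fun x : Fin 8 => (E3 (σ.symm (E3.symm x))).val)

theorem nth_L (σ : Equiv.Perm (Fin (2 + 1) → Fin 2)) (i : Fin 2) (α : Fin 2 → Fin 2) :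
    nth (L σ) (4 * i.val + (E2 α).val) = (E3 (σ.symm (Fin.cons i α))).val := by
  rw [← E3_cons, nth_eq, L, List.getD_eq_getElem _ _ (by simp), List.getElem_ofFn]
  simp only [Fin.eta, Equiv.symm_apply_apply]

theorem nth_half (l : List ℕ) (n : ℕ) : nth (l.map (· / 2)) n = nth l n / 2 := by
  rw [nth_eq, nth_eq]
  exact List.getD_map l 0 (fun x => x / 2)

theorem L_injective : Function.Injective L := by
  intro σ τ h
  have h1 := List.ofFn_injective h
  have h2 : σ.symm = τ.symm := by
    ext1 w
    have := congrFun h1 (E3 w)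
    simpa [Fin.val_inj] using this
  simpa using congrArg Equiv.symm h2

theorem L_nodup (σ : Equiv.Perm (Fin (2 + 1) → Fin 2)) : (L σ).Nodup := by
  rw [L, List.nodup_ofFn]
  intro x y h
  simpa [Fin.val_inj] using h

theorem L_lt (σ : Equiv.Perm (Fin (2 + 1) → Fin 2)) : ∀ a ∈ L σ, a < 8 := by
  intro a ha
  rw [L, List.mem_ofFn] at ha
  obtain ⟨x, rfl⟩ := ha
  exact Fin.isLt _

theorem exists_L (x : List ℕ) (h1 : x.Nodup) (h2 : x.length = 8) (h3 : ∀ a ∈ x, a < 8) :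
    ∃ σ, L σ = x := by
  let f : Fin 8 → Fin 8 := fun i => ⟨x[i.val]'(by omega), h3 _ (List.getElem_mem _)⟩
  have hf : Function.Injective f := by
    intro i j hij
    have := congrArg Fin.val hij
    exact Fin.ext ((List.Nodup.getElem_inj_iff h1).1 this)
  let e : Fin 8 ≃ Fin 8 := Equiv.ofBijective f (Finite.injective_iff_bijective.1 hf)
  refine ⟨((E3.trans e).trans E3.symm).symm, ?_⟩
  apply List.ext_getElem
  · simp [L, h2]
  · intro i hi hi'
    simp only [L, List.getElem_ofFn]
    simp [e, f, -List.ofFn_succ]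

theorem code_mem (α β : Fin 2 → Fin 2) : 4 * (E2 α).val + (E2 β).val ∈ codes := by
  revert α β; decide

theorem code_start (α β : Fin 2 → Fin 2) :
    4 * (E2 α).val + (E2 β).val ∈ start ↔ α = β := by
  revert α β; decide

theorem code_surj : ∀ c ∈ codes, ∃ α β : Fin 2 → Fin 2, 4 * (E2 α).val + (E2 β).val = c := by
  decide

theorem total_iff' (C : List ℕ → ℕ → Bool) :
    total C = true ↔ ∀ α β : Fin 2 → Fin 2,
      ∃ m, 4 * (E2 α).val + (E2 β).val ∈ (next C)^[m] start := by
  rw [total_iff]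
  constructor
  · intro h α β
    exact h _ (code_mem α β)
  · intro h c hc
    obtain ⟨α, β, rfl⟩ := code_surj c hc
    exact h α β

theorem code_div (α β : Fin 2 → Fin 2) :
    Nat.div (4 * (E2 α).val + (E2 β).val) 4 = (E2 α).val := by
  show (4 * (E2 α).val + (E2 β).val) / 4 = _
  omega

theorem code_mod (α β : Fin 2 → Fin 2) :
    Nat.mod (4 * (E2 α).val + (E2 β).val) 4 = (E2 β).val := by
  show (4 * (E2 α).val + (E2 β).val) % 4 = _
  omega

theorem nth_L0 (σ : Equiv.Perm (Fin (2 + 1) → Fin 2)) (α : Fin 2 → Fin 2) :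
    nth (L σ) (E2 α).val = (E3 (σ.symm (Fin.cons 0 α))).val := by
  simpa using nth_L σ 0 α

theorem nth_L1 (σ : Equiv.Perm (Fin (2 + 1) → Fin 2)) (α : Fin 2 → Fin 2) :
    nth (L σ) (Nat.add 4 (E2 α).val) = (E3 (σ.symm (Fin.cons 1 α))).val := by
  simpa using nth_L σ 1 α

theorem cond_and (a b : Bool) : cond a b false = true ↔ a = true ∧ b = true := by
  cases a <;> simp

/-! ### The diagonal condition -/

theorem dC_iff (σ : Equiv.Perm (Fin (2 + 1) → Fin 2)) (S : List ℕ) (α β : Fin 2 → Fin 2) :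
    dC ((L σ).map (· / 2)) S (4 * (E2 α).val + (E2 β).val) = true ↔
      ∀ i, 4 * (E2 (fword σ i α)).val + (E2 (fword σ i β)).val ∈ S := by
  rw [dC, dCell, code_div, code_mod, cond_and, pairMem_iff, pairMem_iff, Fin.forall_fin_two]
  simp only [nth_half, nth_L0, nth_L1, fword, E2_init]

theorem sigma_iff (σ : Equiv.Perm (Fin (2 + 1) → Fin 2)) (m : ℕ) (α β : Fin 2 → Fin 2) :
    (α, β) ∈ SigmaSet (fword σ) m ↔
      4 * (E2 α).val + (E2 β).val ∈ (next (dC ((L σ).map (· / 2))))^[m] start := by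
  induction m generalizing α β with
  | zero => exact (code_start α β).symm
  | succ m ih =>
    rw [Function.iterate_succ_apply', mem_next, dC_iff, ← ih]
    simp only [← ih, code_mem, true_and]
    rfl

theorem diag_iff (σ : Equiv.Perm (Fin (2 + 1) → Fin 2)) :
    diagCond σ ↔ total (dC ((L σ).map (· / 2))) = true := by
  rw [total_iff', diagCond, Set.eq_univ_iff_forall]
  simp only [Prod.forall, Set.mem_iUnion, sigma_iff]

/-! ### The annihilation condition -/

theorem psi_mono {Y ι : Type*} (dag : Y) (g : ι → Y → Y) (m : ℕ) :
    PsiSet dag g m ⊆ PsiSet dag g (m + 1) := by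
  induction m with
  | zero => exact Set.subset_union_left
  | succ m ih =>
    rintro y (hy | hy)
    · exact Or.inl hy
    · exact Or.inr fun j => ih (hy j)

theorem dag_mem {Y ι : Type*} (dag : Y) (g : ι → Y → Y) (m : ℕ) : dag ∈ PsiSet dag g m := by
  cases m with
  | zero => rfl
  | succ m => exact Or.inl rfl

theorem aOne_iff (S : List ℕ) (v w : Fin (2 + 1) → Fin 2) :
    aOne S (E3 v).val (E3 w).val = true ↔ (v (Fin.last 2) = w (Fin.last 2) →
      4 * (E2 (Fin.init v)).val + (E2 (Fin.init w)).val ∈ S) := by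
  rw [E2_init, E2_init, ← Fin.val_inj, E3_last, E3_last, ← pairMem_iff]
  show cond (Nat.beq ((E3 v).val % 2) ((E3 w).val % 2))
    (pairMem S ((E3 v).val / 2) ((E3 w).val / 2)) true = true ↔ _
  cases hb : Nat.beq ((E3 v).val % 2) ((E3 w).val % 2) with
  | true => simp [Nat.eq_of_beq_eq_true hb]
  | false => simp [Nat.ne_of_beq_eq_false hb]

theorem aC_iff (σ : Equiv.Perm (Fin (2 + 1) → Fin 2)) (S : List ℕ) (α β : Fin 2 → Fin 2) :
    aC (L σ) S (4 * (E2 α).val + (E2 β).val) = true ↔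
      ∀ i j, (σ.symm (Fin.cons i α)) (Fin.last 2) = (σ.symm (Fin.cons j β)) (Fin.last 2) →
        4 * (E2 (Fin.init (σ.symm (Fin.cons i α)))).val
          + (E2 (Fin.init (σ.symm (Fin.cons j β)))).val ∈ S := by
  rw [aC, aCell, code_div, code_mod, cond_and, cond_and, cond_and, nth_L0, nth_L0, nth_L1, nth_L1]
  simp only [aOne_iff, Fin.forall_fin_two, and_assoc]

/-- `Ψ_m`, read off on pairs of words. -/
def InPsi (σ : Equiv.Perm (Fin (2 + 1) → Fin 2)) (m : ℕ) (α β : Fin 2 → Fin 2) : Prop :=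
  ∀ h : α ≠ β, (some ⟨(α, β), h⟩ : OffDiag 2 2) ∈
    PsiSet (none : OffDiag 2 2) (fun ij : Fin 2 × Fin 2 => fpair σ ij.1 ij.2) m

theorem fpair_mem (σ : Equiv.Perm (Fin (2 + 1) → Fin 2)) (m : ℕ) (i j : Fin 2)
    (α β : Fin 2 → Fin 2) (h : α ≠ β) :
    fpair σ i j (some ⟨(α, β), h⟩ : OffDiag 2 2) ∈
      PsiSet (none : OffDiag 2 2) (fun ij : Fin 2 × Fin 2 => fpair σ ij.1 ij.2) m ↔
    ((σ.symm (Fin.cons i α)) (Fin.last 2) = (σ.symm (Fin.cons j β)) (Fin.last 2) →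
      InPsi σ m (Fin.init (σ.symm (Fin.cons i α))) (Fin.init (σ.symm (Fin.cons j β)))) := by
  by_cases hc : (σ.symm (Fin.cons i α)) (Fin.last 2) = (σ.symm (Fin.cons j β)) (Fin.last 2) ∧
      Fin.init (σ.symm (Fin.cons i α)) ≠ Fin.init (σ.symm (Fin.cons j β))
  · have e : fpair σ i j (some ⟨(α, β), h⟩ : OffDiag 2 2) = some ⟨(_, _), hc.2⟩ := dif_pos hc
    rw [e]
    exact ⟨fun hm _ _ => hm, fun hm => hm hc.1 hc.2⟩
  · have e : fpair σ i j (some ⟨(α, β), h⟩ : OffDiag 2 2) = none := dif_neg hc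
    rw [e]
    exact ⟨fun _ h1 h2 => absurd ⟨h1, h2⟩ hc, fun _ => dag_mem _ _ _⟩

theorem inPsi_iff (σ : Equiv.Perm (Fin (2 + 1) → Fin 2)) (m : ℕ) (α β : Fin 2 → Fin 2) :
    InPsi σ m α β ↔ 4 * (E2 α).val + (E2 β).val ∈ (next (aC (L σ)))^[m] start := by
  induction m generalizing α β with
  | zero =>
    rw [Function.iterate_zero, id, code_start]
    constructor
    · intro h
      by_contra hne
      have := h hne
      exact absurd this (by intro h'; cases h')
    · intro h hne
      exact absurd h hne
  | succ m ih =>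
    rw [Function.iterate_succ_apply', mem_next, aC_iff]
    simp only [← ih, code_mem, true_and]
    constructor
    · intro h
      by_cases hne : α = β
      · exact Or.inl fun h' => absurd hne h'
      · right
        intro i j
        rw [← fpair_mem σ m i j α β hne]
        rcases h hne with h1 | h1
        · cases h1
        · exact h1 (i, j)
    · rintro (h | h) hne
      · exact psi_mono _ _ m (h hne)
      · exact Or.inr fun ij => (fpair_mem σ m ij.1 ij.2 α β hne).2 (h ij.1 ij.2)

theorem ann_iff (σ : Equiv.Perm (Fin (2 + 1) → Fin 2)) :
    annCond σ ↔ total (aC (L σ)) = true := by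
  rw [total_iff', annCond, Set.eq_univ_iff_forall]
  simp only [Set.mem_iUnion, ← inPsi_iff]
  constructor
  · intro h α β
    by_cases hne : α = β
    · exact ⟨0, fun h' => absurd hne h'⟩
    · obtain ⟨m, hm⟩ := h (some ⟨(α, β), hne⟩)
      exact ⟨m, fun _ => hm⟩
  · rintro h (_ | ⟨⟨α, β⟩, hne⟩)
    · exact ⟨0, rfl⟩
    · obtain ⟨m, hm⟩ := h α β
      exact ⟨m, hm hne⟩

/-! ### Counting -/

theorem card_eq (P : Equiv.Perm (Fin (2 + 1) → Fin 2) → Prop) (R : List (List ℕ))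
    (hR : R.Nodup) (h : ∀ l, l ∈ R ↔ ∃ σ, P σ ∧ L σ = l) :
    Nat.card {σ // P σ} = R.length := by
  have e : L '' {σ | P σ} = (R.toFinset : Set (List ℕ)) := by
    ext l
    simp [h]
  have h1 : Nat.card {σ // P σ} = Set.ncard {σ | P σ} := rfl
  rw [h1, ← Set.ncard_image_of_injective _ L_injective, e, Set.ncard_coe_finset,
    List.toFinset_card_of_nodup hR]

theorem mem_T' (l : List ℕ) : l ∈ T ↔ ∃ σ, diagCond σ ∧ L σ = l := by
  rw [mem_T]
  constructor
  · rintro ⟨h1, h2, h3, h4⟩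
    obtain ⟨σ, rfl⟩ := exists_L l h1 h2 h3
    exact ⟨σ, (diag_iff σ).2 h4, rfl⟩
  · rintro ⟨σ, h, rfl⟩
    exact ⟨L_nodup σ, by simp [L], L_lt σ, (diag_iff σ).1 h⟩

end Cuntz

theorem stmt_10 :
    Nat.card {σ : Equiv.Perm (Fin (2 + 1) → Fin 2) // diagCond σ} = 384 ∧
    Nat.card {σ : Equiv.Perm (Fin (2 + 1) → Fin 2) // diagCond σ ∧ annCond σ} = 48 := by
  constructor
  · rw [Cuntz.card_eq _ _ Cuntz.T_nodup Cuntz.mem_T', Cuntz.T_length]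
  · rw [Cuntz.card_eq _ _ (Cuntz.T_nodup.filter (fun l => Cuntz.total (Cuntz.aC l))),
      Cuntz.T_ann_length]
    intro l
    rw [List.mem_filter, Cuntz.mem_T']
    constructor
    · rintro ⟨⟨σ, h1, rfl⟩, h2⟩
      exact ⟨σ, ⟨h1, (Cuntz.ann_iff σ).2 h2⟩, rfl⟩
    · rintro ⟨σ, ⟨h1, h2⟩, rfl⟩
      exact ⟨⟨σ, h1, rfl⟩, (Cuntz.ann_iff σ).1 h2⟩
end

section
/- Among the 16! permutations of the 16-element set W_2^4, exactly 8!·2^8·17 = 175,472,640 satisfy the diagonal condition. -/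
/-! ## Part 1: automata on `Fin 8` -/

/-- Pairs of transition maps on eight states. -/
abbrev Aut8 := Fin 2 → Fin 8 → Fin 8

/-- Every pair of states is eventually merged. -/
def GoodA (g : Aut8) : Prop := ∀ x y, ∃ m, (x, y) ∈ SigmaSet g m

/-- Every state has exactly two incoming transitions. -/
def IndegA (g : Aut8) : Prop := ∀ z, Fintype.card {p : Fin 2 × Fin 8 // g p.1 p.2 = z} = 2

theorem SigmaSet_mono {X : Type*} {n : ℕ} (f : Fin n → X → X) (m k : ℕ) :
    SigmaSet f m ⊆ SigmaSet f (m + k) := by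
  induction k with
  | zero => exact subset_rfl
  | succ k ih => exact ih.trans (by
      intro p hp
      exact Or.inl hp)

theorem SigmaSet_comm {X : Type*} {n : ℕ} (f : Fin n → X → X) (m : ℕ) :
    ∀ x y, (x, y) ∈ SigmaSet f m → (y, x) ∈ SigmaSet f m := by
  induction m with
  | zero => intro x y h; exact (Eq.symm h : y = x)
  | succ m ih =>
    rintro x y (h | h)
    · exact Or.inl (ih _ _ h)
    · exact Or.inr (fun i => ih _ _ (h i))

theorem SigmaSet_conj {X Y : Type*} {n : ℕ} (e : X ≃ Y) (f : Fin n → Y → Y) (m : ℕ) :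
    ∀ x y, (x, y) ∈ SigmaSet (fun i a => e.symm (f i (e a))) m ↔ (e x, e y) ∈ SigmaSet f m := by
  induction m with
  | zero => intro x y; exact (e.injective.eq_iff (a := x) (b := y)).symm
  | succ m ih =>
    intro x y
    refine or_congr (ih x y) (forall_congr' fun i => ?_)
    have := ih (e.symm (f i (e x))) (e.symm (f i (e y)))
    simpa using this

/-- A height function that decreases along transitions of distinct pairs. -/
theorem GoodA.height {g : Aut8} (hg : GoodA g) :
    ∃ h : Fin 8 → Fin 8 → ℕ, (∀ x y, h x y = h y x) ∧
      ∀ x y i, x ≠ y → h (g i x) (g i y) < h x y := by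
  classical
  refine ⟨fun x y => Nat.find (hg x y), ?_, ?_⟩
  · intro x y
    apply Nat.find_congr'
    intro m
    exact ⟨SigmaSet_comm g m _ _, SigmaSet_comm g m _ _⟩
  · intro x y i hxy
    change Nat.find (hg (g i x) (g i y)) < Nat.find (hg x y)
    have hs := Nat.find_spec (hg x y)
    have hm := fun k => Nat.find_min (hg x y) (m := k)
    generalize Nat.find (hg x y) = m at hs hm ⊢
    cases m with
    | zero => exact absurd hs hxy
    | succ m =>
      rcases hs with hs | hs
      · exact absurd hs (hm m (Nat.lt_succ_self m))
      · exact Nat.lt_succ_of_le (Nat.find_min' (hg (g i x) (g i y)) (hs i))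

/-- Relabelling of the states. -/
def conjA (π : Equiv.Perm (Fin 8)) (g : Aut8) : Aut8 := fun i a => π.symm (g i (π a))

theorem conjA_good {π : Equiv.Perm (Fin 8)} {g : Aut8} (hg : GoodA g) : GoodA (conjA π g) := by
  intro x y
  obtain ⟨m, hm⟩ := hg (π x) (π y)
  exact ⟨m, (SigmaSet_conj π g m x y).2 hm⟩

theorem conjA_indeg {π : Equiv.Perm (Fin 8)} {g : Aut8} (hg : IndegA g) :
    IndegA (conjA π g) := by
  intro z
  refine Eq.trans ?_ (hg (π z))
  refine Fintype.card_congr (Equiv.subtypeEquiv (Equiv.prodCongr (Equiv.refl _) π) ?_)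
  rintro ⟨i, a⟩
  simp only [conjA, Equiv.prodCongr_apply, Prod.map, Equiv.refl_apply]
  exact Equiv.symm_apply_eq π

theorem conjA_conjA_symm (π : Equiv.Perm (Fin 8)) (g : Aut8) : conjA π (conjA π.symm g) = g := by
  funext i a; simp [conjA]

theorem conjA_symm_conjA (π : Equiv.Perm (Fin 8)) (g : Aut8) : conjA π.symm (conjA π g) = g := by
  funext i a; simp [conjA]

/-- The automata to be counted. -/
def OkA (g : Aut8) : Prop := GoodA g ∧ IndegA g

/-- Number of automata to be counted that satisfy a further property. -/
noncomputable def NA (P : Aut8 → Prop) : ℕ := Nat.card {g : Aut8 // OkA g ∧ P g}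

theorem NA_congr_conj (π : Equiv.Perm (Fin 8)) (P Q : Aut8 → Prop)
    (h : ∀ g, P g → Q (conjA π g)) (h' : ∀ g, Q g → P (conjA π.symm g)) : NA P = NA Q :=
  Nat.card_congr
    { toFun := fun g => ⟨conjA π g.1, ⟨conjA_good g.2.1.1, conjA_indeg g.2.1.2⟩, h _ g.2.2⟩
      invFun := fun g => ⟨conjA π.symm g.1, ⟨conjA_good g.2.1.1, conjA_indeg g.2.1.2⟩, h' _ g.2.2⟩
      left_inv := fun g => Subtype.ext (conjA_symm_conjA π g.1)
      right_inv := fun g => Subtype.ext (conjA_conjA_symm π g.1) }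

theorem NA_congr_ok (P Q : Aut8 → Prop) (h : ∀ g, OkA g → (P g ↔ Q g)) : NA P = NA Q :=
  Nat.card_congr (Equiv.subtypeEquivRight fun g => and_congr_right (h g))

theorem NA_split (P : Aut8 → Prop) (F : Aut8 → Fin 8) :
    NA P = ∑ z, NA (fun g => P g ∧ F g = z) := by
  have e : {g : Aut8 // OkA g ∧ P g} ≃ Σ z : Fin 8, {g : Aut8 // OkA g ∧ P g ∧ F g = z} :=
    { toFun := fun g => ⟨F g.1, g.1, g.2.1, g.2.2, rfl⟩
      invFun := fun q => ⟨q.2.1, q.2.2.1, q.2.2.2.1⟩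
      left_inv := fun g => rfl
      right_inv := by rintro ⟨z, g, h1, h2, rfl⟩; rfl }
  unfold NA
  rw [Nat.card_congr e, Nat.card_sigma]

theorem NA_eq_zero (P : Aut8 → Prop) (h : ∀ g, OkA g → P g → False) : NA P = 0 := by
  have : IsEmpty {g : Aut8 // OkA g ∧ P g} := ⟨fun g => h g.1 g.2.1 g.2.2⟩
  exact Nat.card_of_isEmpty

theorem NA_eq_one (P : Aut8 → Prop) (g₀ : Aut8) (h₀ : OkA g₀) (h : ∀ g, P g ↔ g = g₀) :
    NA P = 1 := by
  unfold NA
  rw [Nat.card_eq_one_iff_unique]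
  refine ⟨⟨fun a b => Subtype.ext ?_⟩, ⟨⟨g₀, h₀, (h g₀).2 rfl⟩⟩⟩
  rw [(h a.1).1 a.2.2, (h b.1).1 b.2.2]

theorem NA_congr (P Q : Aut8 → Prop) (h : ∀ g, P g ↔ Q g) : NA P = NA Q := by
  have : P = Q := funext fun g => propext (h g)
  rw [this]

/-! ### The unique fixed point of the first map -/

theorem GoodA.exists_fixed {g : Aut8} (hg : GoodA g) : ∃ z, g 0 z = z := by
  obtain ⟨h, _, hlt⟩ := hg.height
  have key : ∀ n x, h x (g 0 x) ≤ n → ∃ z, g 0 z = z := by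
    intro n
    induction n with
    | zero =>
      intro x hx
      by_contra hne
      push Not at hne
      have := hlt x (g 0 x) 0 (hne x).symm
      omega
    | succ n ih =>
      intro x hx
      by_cases hne : g 0 x = x
      · exact ⟨x, hne⟩
      · have := hlt x (g 0 x) 0 (Ne.symm hne)
        exact ih (g 0 x) (by omega)
  exact key _ 0 le_rfl

theorem GoodA.fixed_unique {g : Aut8} (hg : GoodA g) {x y : Fin 8} (hx : g 0 x = x)
    (hy : g 0 y = y) : x = y := by
  obtain ⟨h, _, hlt⟩ := hg.height
  by_contra hne
  have := hlt x y 0 hne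
  rw [hx, hy] at this
  omega

theorem NA_root : NA (fun _ => True) = 8 * NA (fun g => g 0 0 = 0) := by
  classical
  have h1 : NA (fun _ => True) = ∑ z, NA (fun g => g 0 z = z) := by
    let F : Aut8 → Fin 8 := fun g => if h : ∃ z, g 0 z = z then h.choose else 0
    rw [NA_split _ F]
    refine Finset.sum_congr rfl fun z _ => ?_
    refine NA_congr_ok _ _ fun g hok => ?_
    rw [true_and]
    have hex := hok.1.exists_fixed
    have hF : F g = hex.choose := by simp only [F, dif_pos hex]
    rw [hF]
    constructor
    · intro h; rw [← h]; exact hex.choose_spec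
    · intro h; exact hok.1.fixed_unique hex.choose_spec h
  rw [h1]
  have h2 : ∀ z : Fin 8, NA (fun g => g 0 z = z) = NA (fun g => g 0 0 = 0) := by
    intro z
    refine NA_congr_conj (Equiv.swap 0 z) _ _ ?_ ?_
    · intro g hg; simp [conjA, hg]
    · intro g hg; simp [conjA, hg]
  rw [Finset.sum_congr rfl fun z _ => h2 z, Finset.sum_const, Finset.card_univ,
    Fintype.card_fin, smul_eq_mul]

/-! ### Partial automata, encoded in base 16 -/

/-- Digit `t` of `p`: `0` if undefined, `z+1` if the transition number `t` goes to `z`. -/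
def look (p t : ℕ) : ℕ := p / 16 ^ t % 16

/-- Define transition `t` as `z`. -/
def upd (p t z : ℕ) : ℕ := p + (z + 1) * 16 ^ t

theorem look_upd_self {p t z : ℕ} (h : look p t = 0) (hz : z < 8) :
    look (upd p t z) t = z + 1 := by
  unfold look upd at *
  rw [Nat.add_mul_div_right _ _ (by positivity)]
  omega

theorem look_upd_of_ne {p t z s : ℕ} (h : look p t = 0) (hz : z < 8) (hs : s ≠ t) :
    look (upd p t z) s = look p s := by
  unfold look upd at *
  rcases Nat.lt_or_gt_of_ne hs with hlt | hlt
  · obtain ⟨d, rfl⟩ := Nat.exists_eq_add_of_lt hlt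
    have : (z + 1) * 16 ^ (s + d + 1) = ((z + 1) * 16 ^ d * 16) * 16 ^ s := by ring
    rw [this, Nat.add_mul_div_right _ _ (by positivity)]
    omega
  · obtain ⟨d, rfl⟩ := Nat.exists_eq_add_of_lt hlt
    have e : (16 : ℕ) ^ (t + d + 1) = 16 ^ t * (16 * 16 ^ d) := by ring
    rw [e, ← Nat.div_div_eq_div_mul, ← Nat.div_div_eq_div_mul, ← Nat.div_div_eq_div_mul,
      ← Nat.div_div_eq_div_mul, Nat.add_mul_div_right _ _ (by positivity)]
    congr 2
    omega

/-- The number of a transition. -/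
def slot (i : Fin 2) (x : Fin 8) : ℕ := 2 * x.val + i.val

theorem slot_inj {i j : Fin 2} {x y : Fin 8} : slot i x = slot j y ↔ i = j ∧ x = y := by
  unfold slot
  rw [Fin.ext_iff, Fin.ext_iff]
  omega

/-- `g` extends the partial automaton `p`. -/
def PExt (p : ℕ) (g : Aut8) : Prop :=
  ∀ i x, look p (slot i x) ≠ 0 → look p (slot i x) = (g i x).val + 1

theorem Ext_upd {p : ℕ} {i : Fin 2} {x : Fin 8} {z : ℕ} (h : look p (slot i x) = 0) (hz : z < 8)
    (g : Aut8) : PExt (upd p (slot i x) z) g ↔ PExt p g ∧ (g i x).val = z := by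
  constructor
  · intro hE
    refine ⟨?_, ?_⟩
    · intro j y hy
      have hne : slot j y ≠ slot i x := by
        intro hh; rw [hh] at hy; exact hy h
      have := hE j y
      rw [look_upd_of_ne h hz hne] at this
      exact this hy
    · have := hE i x
      rw [look_upd_self h hz] at this
      have := this (by omega)
      omega
  · rintro ⟨hE, hg⟩ j y
    by_cases hne : slot j y = slot i x
    · obtain ⟨rfl, rfl⟩ := slot_inj.1 hne
      rw [look_upd_self h hz]
      intro _; omega
    · rw [look_upd_of_ne h hz hne]
      exact hE j y

/-- States `≥ u` do not occur in `p`. -/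
def PInv (p u : ℕ) : Prop :=
  ∀ i x, look p (slot i x) ≠ 0 → x.val < u ∧ look p (slot i x) ≤ u

theorem PInv.mono {p u v : ℕ} (h : PInv p u) (huv : u ≤ v) : PInv p v := by
  intro i x hx
  have := h i x hx
  omega

theorem PInv.upd {p u : ℕ} {i : Fin 2} {x : Fin 8} {z : ℕ} (hI : PInv p u)
    (h : look p (slot i x) = 0) (hz : z < 8) (hx : x.val < u) :
    PInv (upd p (slot i x) z) (max u (z + 1)) := by
  intro j y
  by_cases hne : slot j y = slot i x
  · obtain ⟨rfl, rfl⟩ := slot_inj.1 hne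
    rw [look_upd_self h hz]
    intro _; omega
  · rw [look_upd_of_ne h hz hne]
    intro hy
    have := hI j y hy
    omega

theorem Ext_conj_swap {p u : ℕ} (hI : PInv p u) {a b : Fin 8} (ha : u ≤ a.val) (hb : u ≤ b.val)
    {g : Aut8} (hg : PExt p g) : PExt p (conjA (Equiv.swap a b) g) := by
  intro i x hx
  have h1 := hI i x hx
  have h2 := hg i x hx
  have e1 : Equiv.swap a b x = x := by
    apply Equiv.swap_apply_of_ne_of_ne <;> (rintro rfl; omega)
  have e2 : Equiv.swap a b (g i x) = g i x := by
    apply Equiv.swap_apply_of_ne_of_ne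
    · intro hh; rw [hh] at h2; omega
    · intro hh; rw [hh] at h2; omega
  simp only [conjA, e1, Equiv.symm_swap, e2]
  exact h2

theorem NA_fresh {p u : ℕ} (hI : PInv p u) {i : Fin 2} {x : Fin 8} (hx : x.val < u)
    (h : look p (slot i x) = 0) {a b : Fin 8} (ha : u ≤ a.val) (hb : u ≤ b.val) :
    NA (PExt (upd p (slot i x) a.val)) = NA (PExt (upd p (slot i x) b.val)) := by
  have e1 : Equiv.swap a b x = x := by
    apply Equiv.swap_apply_of_ne_of_ne <;> (rintro rfl; omega)
  refine NA_congr_conj (Equiv.swap a b) _ _ ?_ ?_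
  · intro g hg
    rw [Ext_upd h a.2] at hg
    rw [Ext_upd h b.2]
    refine ⟨Ext_conj_swap hI ha hb hg.1, ?_⟩
    have : g i x = a := Fin.ext hg.2
    simp [conjA, e1, this]
  · intro g hg
    rw [Ext_upd h b.2] at hg
    rw [Ext_upd h a.2]
    rw [Equiv.symm_swap]
    refine ⟨Ext_conj_swap hI ha hb hg.1, ?_⟩
    have : g i x = b := Fin.ext hg.2
    simp [conjA, e1, this]

/-- Weight of the value `z`. -/
def wt (u z : ℕ) : ℕ := if z = u then 8 - u else 1

theorem NA_branch {p u : ℕ} (hI : PInv p u) {i : Fin 2} {x : Fin 8} (hx : x.val < u)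
    (h : look p (slot i x) = 0) (hu : u ≤ 8) :
    NA (PExt p) = ∑ z ∈ Finset.range (min (u + 1) 8), wt u z * NA (PExt (upd p (slot i x) z)) := by
  rw [NA_split (PExt p) (fun g => g i x)]
  have h1 : ∀ z : Fin 8, NA (fun g => PExt p g ∧ g i x = z) = NA (PExt (upd p (slot i x) z.val)) := by
    intro z
    apply NA_congr
    intro g
    rw [Ext_upd h z.2, Fin.ext_iff]
  simp only [h1]
  rw [Fin.sum_univ_eq_sum_range (fun z => NA (PExt (upd p (slot i x) z))) 8]
  rcases Nat.lt_or_ge u 8 with hlt | hge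
  · rw [min_eq_left (by omega), Finset.sum_range_succ _ u,
      ← Finset.sum_range_add_sum_Ico _ hu]
    congr 1
    · refine Finset.sum_congr rfl fun z hz => ?_
      have : z ≠ u := by have := Finset.mem_range.1 hz; omega
      simp [wt, this]
    · have : ∀ z ∈ Finset.Ico u 8, NA (PExt (upd p (slot i x) z)) = NA (PExt (upd p (slot i x) u)) := by
        intro z hz
        rw [Finset.mem_Ico] at hz
        exact NA_fresh hI hx h (a := ⟨z, hz.2⟩) (b := ⟨u, hlt⟩) hz.1 le_rfl
      rw [Finset.sum_congr rfl this]
      simp [wt]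
  · have : u = 8 := by omega
    subst this
    refine Finset.sum_congr rfl fun z hz => ?_
    have : z ≠ 8 := by have := Finset.mem_range.1 hz; omega
    simp [wt, this]

/-! ### Pruning -/

/-- Number of the first `n` transitions of `p` that go to `z`. -/
def cnt (p z : ℕ) : ℕ → ℕ
  | 0 => 0
  | n + 1 => (if Nat.beq (look p n) (z + 1) then 1 else 0) + cnt p z n

/-- Bounded search for a path between pairs of states. -/
def reach (p x y : ℕ) : ℕ → ℕ → ℕ → Bool
  | 0, _, _ => false
  | f + 1, a, b =>
    (Nat.beq a x && Nat.beq b y) || (Nat.beq a y && Nat.beq b x) ||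
    (match look p (2 * a), look p (2 * b) with
      | c + 1, d + 1 => !(Nat.beq c d) && reach p x y f c d
      | _, _ => false) ||
    (match look p (2 * a + 1), look p (2 * b + 1) with
      | c + 1, d + 1 => !(Nat.beq c d) && reach p x y f c d
      | _, _ => false)

/-- Does the transition `i` from `x` to `z` close a cycle of pairs `(x, y)`, for `y < n`? -/
def cyc (p i x z : ℕ) : ℕ → Bool
  | 0 => false
  | y + 1 =>
    (match look p (2 * y + i) with
      | w + 1 => !(Nat.beq y x) && !(Nat.beq z w) && reach p x y 9 z w
      | 0 => false) || cyc p i x z y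

theorem PExt.look {p : ℕ} {g : Aut8} (hE : PExt p g) {i x c : ℕ} (hi : i < 2) (hx : x < 8)
    (h : look p (2 * x + i) = c + 1) : (g ⟨i, hi⟩ ⟨x, hx⟩).val = c := by
  have := hE ⟨i, hi⟩ ⟨x, hx⟩
  simp only [slot] at this
  rw [h] at this
  have := this (by omega)
  omega

theorem reach_sound {p : ℕ} {g : Aut8} (hE : PExt p g) {h : Fin 8 → Fin 8 → ℕ}
    (hc : ∀ x y, h x y = h y x) (hlt : ∀ x y i, x ≠ y → h (g i x) (g i y) < h x y)
    (x y : Fin 8) (f : ℕ) :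
    ∀ a b : Fin 8, a ≠ b → reach p x.val y.val f a.val b.val = true → h x y ≤ h a b := by
  induction f with
  | zero => intro a b _ hr; simp [reach] at hr
  | succ f ih =>
    intro a b hab hr
    have step : ∀ i : ℕ, i < 2 → (match _root_.look p (2 * a.val + i), _root_.look p (2 * b.val + i) with
      | c + 1, d + 1 => !(Nat.beq c d) && reach p x y f c d
      | _, _ => false) = true → h x y ≤ h a b := by
      intro i hi hm
      split at hm
      · rename_i c d hc1 hd1
        have h1 := hE.look hi a.2 hc1
        have h2 := hE.look hi b.2 hd1
        rw [Bool.and_eq_true, ← h1, ← h2] at hm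
        have hl := hlt a b ⟨i, hi⟩ hab
        have hne : g ⟨i, hi⟩ a ≠ g ⟨i, hi⟩ b := by
          intro hh
          have := hm.1
          rw [show g ⟨i, hi⟩ ⟨a.val, a.2⟩ = g ⟨i, hi⟩ ⟨b.val, b.2⟩ from hh] at this
          simp at this
        exact (ih _ _ hne hm.2).trans hl.le
      · simp at hm
    rw [reach, Bool.or_eq_true, Bool.or_eq_true, Bool.or_eq_true, Bool.and_eq_true,
      Bool.and_eq_true, Nat.beq_eq, Nat.beq_eq, Nat.beq_eq, Nat.beq_eq] at hr
    rcases hr with ((hr | hr) | hr) | hr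
    · rw [Fin.ext hr.1, Fin.ext hr.2]
    · rw [Fin.ext hr.1, Fin.ext hr.2, hc]
    · exact step 0 (by omega) hr
    · exact step 1 (by omega) hr

theorem cyc_sound {p : ℕ} {g : Aut8} (hE : PExt p g) (hg : GoodA g) (i : Fin 2) (x : Fin 8)
    (n : ℕ) (hn : n ≤ 8) : cyc p i.val x.val (g i x).val n = false := by
  obtain ⟨h, hc, hlt⟩ := hg.height
  induction n with
  | zero => rfl
  | succ y ih =>
    rw [cyc, ih (by omega), Bool.or_false]
    split
    · rename_i w hw
      have h1 := hE.look i.2 (show y < 8 by omega) hw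
      rw [← h1]
      by_contra hcon
      rw [Bool.not_eq_false, Bool.and_eq_true, Bool.and_eq_true] at hcon
      obtain ⟨⟨hyx, hne⟩, hr⟩ := hcon
      have hyx' : x ≠ ⟨y, by omega⟩ := by
        rintro rfl; simp at hyx
      have hne' : g i x ≠ g i ⟨y, by omega⟩ := by
        intro hh; rw [hh] at hne; simp at hne
      have := reach_sound hE hc hlt x ⟨y, by omega⟩ 9 _ _ hne' hr
      have := hlt _ _ i hyx'
      omega
    · rfl

theorem card_slots (g : Aut8) (z : Fin 8) :
    Fintype.card {p : Fin 2 × Fin 8 // g p.1 p.2 = z} =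
      ∑ i : Fin 2, ∑ x : Fin 8, if g i x = z then 1 else 0 := by
  rw [Fintype.card_subtype, Finset.card_filter, Fintype.sum_prod_type]

theorem cnt_sound {p : ℕ} {g : Aut8} (hE : PExt p g) (hg : IndegA g) (z : Fin 8) :
    cnt p z.val 16 ≤ 2 := by
  rw [← hg z, card_slots]
  have key : ∀ (i : ℕ) (x : ℕ) (hi : i < 2) (hx : x < 8),
      (if Nat.beq (look p (2 * x + i)) (z.val + 1) then 1 else 0) ≤
        if g ⟨i, hi⟩ ⟨x, hx⟩ = z then 1 else 0 := by
    intro i x hi hx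
    split_ifs with h1 h2
    · rfl
    · exact absurd (Fin.ext (hE.look hi hx (Nat.eq_of_beq_eq_true h1))) h2
    · omega
    · omega
  have hsum : cnt p z.val 16 = ∑ i : Fin 2, ∑ x : Fin 8,
      if Nat.beq (look p (2 * x.val + i.val)) (z.val + 1) then 1 else 0 := by
    simp only [cnt, Fin.sum_univ_two, Fin.sum_univ_eight]
    simp
    omega
  rw [hsum]
  exact Finset.sum_le_sum fun i _ => Finset.sum_le_sum fun x _ => key i.val x.val i.2 x.2

/-- Should the extension by the value `z` at transition `i` from `x` be discarded? -/
def ruled (p i x z : ℕ) : Bool := Nat.ble 3 (cnt p z 16) || cyc p i x z 8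

theorem ruled_sound {p : ℕ} {i : Fin 2} {x : Fin 8} {z : ℕ} (h : look p (slot i x) = 0)
    (hz : z < 8) (hr : ruled (upd p (slot i x) z) i.val x.val z = true) :
    NA (PExt (upd p (slot i x) z)) = 0 := by
  apply NA_eq_zero
  intro g hok hE
  have hgz := ((Ext_upd h hz g).1 hE).2
  rw [ruled, Bool.or_eq_true] at hr
  rcases hr with hr | hr
  · have := cnt_sound hE hok.2 ⟨z, hz⟩
    have := Nat.le_of_ble_eq_true hr
    simp only at *
    omega
  · have := cyc_sound hE hok.1 i x 8 le_rfl
    rw [hgz, hr] at this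
    cases this

/-! ### Leaves -/

/-- Are the states `a`, `b` merged after at most `f` steps? -/
def merge (p : ℕ) : ℕ → ℕ → ℕ → Bool
  | 0, a, b => Nat.beq a b
  | f + 1, a, b => Nat.beq a b ||
      (merge p f (look p (2 * a) - 1) (look p (2 * b) - 1) &&
        merge p f (look p (2 * a + 1) - 1) (look p (2 * b + 1) - 1))

/-- Bounded universal quantifier. -/
def allB (P : ℕ → Bool) : ℕ → Bool
  | 0 => true
  | n + 1 => P n && allB P n

theorem allB_spec {P : ℕ → Bool} {n : ℕ} (h : allB P n = true) : ∀ k < n, P k = true := by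
  induction n with
  | zero => intro k hk; omega
  | succ n ih =>
    rw [allB, Bool.and_eq_true] at h
    intro k hk
    rcases Nat.lt_succ_iff_lt_or_eq.1 hk with h' | rfl
    · exact ih h.2 k h'
    · exact h.1

/-- Is `p` a complete automaton with the required properties? -/
def leafOk (p : ℕ) : Bool :=
  allB (fun t => Nat.ble 1 (look p t) && Nat.ble (look p t) 8) 16 &&
  allB (fun z => Nat.beq (cnt p z 16) 2) 8 &&
  allB (fun a => allB (fun b => merge p 8 a b) a) 8

theorem leaf_sound {p : ℕ} (h : leafOk p = true) : NA (PExt p) = 1 := by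
  rw [leafOk, Bool.and_eq_true, Bool.and_eq_true] at h
  obtain ⟨⟨h1, h2⟩, h3⟩ := h
  have hd : ∀ t < 16, 1 ≤ look p t ∧ look p t ≤ 8 := by
    intro t ht
    have := allB_spec h1 t ht
    rw [Bool.and_eq_true] at this
    exact ⟨Nat.le_of_ble_eq_true this.1, Nat.le_of_ble_eq_true this.2⟩
  have hs : ∀ i x, slot i x < 16 := by intro i x; unfold slot; omega
  let g₀ : Aut8 := fun i x => ⟨look p (slot i x) - 1, by have := hd _ (hs i x); omega⟩
  have hg₀ : ∀ i x, look p (slot i x) = (g₀ i x).val + 1 := by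
    intro i x
    have := hd _ (hs i x)
    simp only [g₀]; omega
  refine NA_eq_one _ g₀ ⟨?_, ?_⟩ ?_
  · have hm : ∀ f, ∀ a b : Fin 8, merge p f a.val b.val = true → (a, b) ∈ SigmaSet g₀ f := by
      intro f
      induction f with
      | zero => intro a b hab; exact Fin.ext (Nat.eq_of_beq_eq_true hab)
      | succ f ih =>
        intro a b hab
        rw [merge, Bool.or_eq_true, Bool.and_eq_true] at hab
        rcases hab with hab | hab
        · have := Fin.ext (Nat.eq_of_beq_eq_true hab)
          subst this
          have : (a, a) ∈ SigmaSet g₀ 0 := rfl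
          have := SigmaSet_mono g₀ 0 (f + 1) this
          simpa using this
        · right
          intro i
          have : i = 0 ∨ i = 1 := by omega
          rcases this with rfl | rfl
          · exact ih (g₀ 0 a) (g₀ 0 b) hab.1
          · exact ih (g₀ 1 a) (g₀ 1 b) hab.2
    intro x y
    refine ⟨8, ?_⟩
    rcases lt_trichotomy x y with hxy | hxy | hxy
    · exact SigmaSet_comm _ _ _ _ (hm 8 y x (allB_spec (allB_spec h3 y.val y.2) x.val hxy))
    · subst hxy
      have : (x, x) ∈ SigmaSet g₀ 0 := rfl
      exact SigmaSet_mono g₀ 0 8 this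
    · exact hm 8 x y (allB_spec (allB_spec h3 x.val x.2) y.val hxy)
  · intro z
    rw [card_slots]
    refine Eq.trans ?_ (Nat.eq_of_beq_eq_true (allB_spec h2 z.val z.2))
    have key : ∀ i x, (if g₀ i x = z then 1 else 0) =
        if Nat.beq (look p (2 * x.val + i.val)) (z.val + 1) then 1 else 0 := by
      intro i x
      have := hg₀ i x
      simp only [slot] at this
      rw [this]
      simp [Fin.ext_iff]
    simp only [key]
    simp only [cnt, Fin.sum_univ_two, Fin.sum_univ_eight]
    simp
    omega
  · intro g
    constructor
    · intro hE
      funext i x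
      have h1 := hE i x (by have := hd _ (hs i x); omega)
      rw [hg₀] at h1
      exact Fin.ext (by omega)
    · rintro rfl i x _
      exact hg₀ i x

/-! ### The search -/

/-- Evaluate a number before passing it on. -/
def force {α : Type} (n : ℕ) (f : ℕ → α) : α := Nat.rec (f 0) (fun m _ => f m) (n + 1)

theorem force_eq {α : Type} (n : ℕ) (f : ℕ → α) : force n f = f n := rfl

/-- Loop over the values `z, z+1, …, z+n-1` of transition `i` from `x`. -/
def loop (rec : ℕ → ℕ → ℕ → (ℕ → ℕ → Bool) → Bool) (p i x u : ℕ) (k : ℕ → ℕ → Bool) :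
    ℕ → ℕ → ℕ → ℕ → Bool
  | 0, _, acc, c => k acc c
  | n + 1, z, acc, c =>
    force (upd p (2 * x + i) z) fun q =>
      cond (ruled q i x z) (force (z + 1) fun z' => loop rec p i x u k n z' acc c)
        (force (max u (z + 1)) fun v => rec q v c fun m c' =>
          force (acc + wt u z * m) fun acc' => force (z + 1) fun z' =>
            loop rec p i x u k n z' acc' c')

/-- Depth-first search. The base 16 digits of `c` say where to branch. -/
def srch : ℕ → ℕ → ℕ → ℕ → (ℕ → ℕ → Bool) → Bool
  | 0, _, _, _, _ => false
  | f + 1, p, u, c, k =>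
    force (c / 16) fun c' => force (c % 16) fun s =>
      cond (Nat.beq s 0) (leafOk p && k 1 c')
        (force (s / 2) fun x => force (s % 2) fun i => force (max u (x + 1)) fun v =>
          Nat.beq (look p (2 * x + i)) 0 && loop (srch f) p i x v k (min (v + 1) 8) 0 0 c')

theorem loop_succ (rec : ℕ → ℕ → ℕ → (ℕ → ℕ → Bool) → Bool) (p i x u : ℕ) (k : ℕ → ℕ → Bool)
    (n z acc c : ℕ) : loop rec p i x u k (n + 1) z acc c =
      cond (ruled (upd p (2 * x + i) z) i x z) (loop rec p i x u k n (z + 1) acc c)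
        (rec (upd p (2 * x + i) z) (max u (z + 1)) c fun m c' =>
          loop rec p i x u k n (z + 1) (acc + wt u z * m) c') := rfl

theorem loop_sound (rec : ℕ → ℕ → ℕ → (ℕ → ℕ → Bool) → Bool)
    (hrec : ∀ p u c k, PInv p u → u ≤ 8 → rec p u c k = true → ∃ c', k (NA (PExt p)) c' = true)
    {p u : ℕ} (i : Fin 2) (x : Fin 8) (hI : PInv p u) (hx : x.val < u) (hu : u ≤ 8)
    (h : look p (slot i x) = 0) (k : ℕ → ℕ → Bool) (n : ℕ) :
    ∀ z acc c, z + n ≤ 8 → loop rec p i.val x.val u k n z acc c = true →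
      ∃ c', k (acc + ∑ y ∈ Finset.range n,
        wt u (z + y) * NA (PExt (upd p (slot i x) (z + y)))) c' = true := by
  induction n with
  | zero => intro z acc c _ hl; exact ⟨c, by simpa [loop] using hl⟩
  | succ n ih =>
    intro z acc c hz hl
    rw [loop_succ] at hl
    rw [Finset.sum_range_succ']
    have hre : ∀ y, z + (y + 1) = (z + 1) + y := by intro y; omega
    rw [Finset.sum_congr rfl fun y _ => by rw [hre y], Nat.add_zero z]
    rw [← add_assoc, add_right_comm]
    change cond (ruled (upd p (slot i x) z) i.val x.val z) _ _ = true at hl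
    cases hr : ruled (upd p (slot i x) z) i.val x.val z with
    | true =>
      rw [hr, cond_true] at hl
      rw [ruled_sound h (by omega) hr, mul_zero, add_zero]
      exact ih _ _ _ (by omega) hl
    | false =>
      rw [hr, cond_false] at hl
      obtain ⟨c', hc'⟩ := hrec _ _ _ _ (hI.upd h (by omega) hx) (by omega) hl
      exact ih _ _ _ (by omega) hc'

theorem srch_sound (f : ℕ) : ∀ p u c k, PInv p u → u ≤ 8 → srch f p u c k = true →
    ∃ c', k (NA (PExt p)) c' = true := by
  induction f with
  | zero => intro p u c k _ _ h; simp [srch] at h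
  | succ f ih =>
    intro p u c k hI hu h
    rw [srch] at h
    simp only [force_eq] at h
    cases hs : Nat.beq (c % 16) 0 with
    | true =>
      rw [hs, cond_true, Bool.and_eq_true] at h
      rw [leaf_sound h.1]
      exact ⟨_, h.2⟩
    | false =>
      rw [hs, cond_false, Bool.and_eq_true] at h
      have hx : c % 16 / 2 < 8 := by omega
      have hi : c % 16 % 2 < 2 := by omega
      have h0 := Nat.eq_of_beq_eq_true h.1
      have hI' := hI.mono (le_max_left u (c % 16 / 2 + 1))
      have hlt : c % 16 / 2 < max u (c % 16 / 2 + 1) := by omega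
      have hle : max u (c % 16 / 2 + 1) ≤ 8 := by omega
      obtain ⟨c', hc'⟩ := loop_sound (srch f) ih ⟨_, hi⟩ ⟨_, hx⟩ hI' hlt hle h0 k _ 0 0 _
        (by omega) h.2
      refine ⟨c', ?_⟩
      rw [NA_branch hI' (i := ⟨_, hi⟩) (x := ⟨_, hx⟩) hlt h0 hle]
      simpa using hc'

/-- Branching instructions for the search. -/
def cert : ℕ := 38060715572890648463206154536094728697041820620666347089988579600831285812064210419275127122721324921791099263255415057997062274718091721885020859450845067791987883927140810566690691729752264468402326994878367920528174952467788407764424775301314293292576901850367375735643036162936561177783156556431425326695340509946443290729124609485430904376746606141958984361769934552771607593013865051476002565530518996520614737534118315234039887381705781340162894026440991917512875169027111857626408226198102888929268079173633349470128008908138376802716979793878476969162704726463261842655659417823490187652152349914197635377285070484601408542075399955151580834402980716802211815367150862687129179832406775035952721995686292192186869898004002150442184340201467123896787587933452490885646898732486260463828676624315436694780203304217043559457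

theorem srch_run : srch 17 1 1 cert (fun n _ => Nat.beq n 85680) = true := by
  decide +kernel

theorem look_one (t : ℕ) : look 1 t = if t = 0 then 1 else 0 := by
  unfold look
  cases t with
  | zero => rfl
  | succ t =>
    have : 1 / 16 ^ (t + 1) = 0 := Nat.div_eq_of_lt (Nat.one_lt_pow (by omega) (by omega))
    rw [this]; rfl

theorem slot_eq_zero {i : Fin 2} {x : Fin 8} : slot i x = 0 ↔ i = 0 ∧ x = 0 := by
  rw [← slot_inj]; rfl

theorem NA_base : NA (fun g => g 0 0 = 0) = 85680 := by
  have hI : PInv 1 1 := by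
    intro i x
    rw [look_one]
    split_ifs with h
    · rw [slot_eq_zero] at h
      rw [h.2]; simp
    · intro h; exact absurd rfl h
  obtain ⟨_, h⟩ := srch_sound 17 1 1 cert (fun n _ => Nat.beq n 85680) hI (by decide) srch_run
  rw [← Nat.eq_of_beq_eq_true h]
  apply NA_congr
  intro g
  constructor
  · intro hg i x hx
    rw [look_one] at hx ⊢
    split_ifs at hx ⊢ with h
    · rw [slot_eq_zero] at h
      rw [h.1, h.2, hg]; rfl
    · exact absurd rfl hx
  · intro hE
    have := hE 0 0
    rw [look_one, if_pos (by rfl)] at this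
    have := this (by omega)
    exact Fin.ext (by simpa using this)

theorem NA_total : NA (fun _ => True) = 685440 := by
  rw [NA_root, NA_base]

/-! ## Part 2: from permutations to automata -/

/-- Lifts of a map `G` to a bijection onto `X × Fin 2`. -/
def liftEquiv {P X : Type} (G : P → X) :
    {τ : P ≃ X × Fin 2 // ∀ p, (τ p).1 = G p} ≃ ((x : X) → ({p // G p = x} ≃ Fin 2)) where
  toFun τ x :=
    { toFun := fun p => (τ.1 p.1).2
      invFun := fun j => ⟨τ.1.symm (x, j), by rw [← τ.2]; simp⟩
      left_inv := by
        rintro ⟨p, hp⟩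
        apply Subtype.ext
        simp only
        rw [Equiv.symm_apply_eq]
        exact Prod.ext (by rw [τ.2, hp]) rfl
      right_inv := by intro j; simp }
  invFun φ :=
    ⟨{ toFun := fun p => (G p, φ (G p) ⟨p, rfl⟩)
       invFun := fun q => ((φ q.1).symm q.2).1
       left_inv := by intro p; simp
       right_inv := by
        rintro ⟨x, j⟩
        have key : ∀ (y : {p // G p = x}), (G y.1, φ (G y.1) ⟨y.1, rfl⟩) = (x, φ x y) := by
          rintro ⟨p, rfl⟩; rfl
        have := key ((φ x).symm j)
        simpa using this }, fun p => rfl⟩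
  left_inv := by
    rintro ⟨τ, hτ⟩
    apply Subtype.ext
    ext p
    · simp [hτ]
    · simp
  right_inv := by
    intro φ
    funext x
    ext ⟨p, rfl⟩
    rfl

/-- The automaton of a bijection. -/
def autOf (τ : Fin 2 × Fin 8 ≃ Fin 8 × Fin 2) : Aut8 := fun i a => (τ (i, a)).1

theorem card_lifts (g : Aut8) (hg : IndegA g) :
    Nat.card {τ : Fin 2 × Fin 8 ≃ Fin 8 × Fin 2 // autOf τ = g} = 256 := by
  classical
  have e : {τ : Fin 2 × Fin 8 ≃ Fin 8 × Fin 2 // autOf τ = g} ≃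
      ((x : Fin 8) → ({p : Fin 2 × Fin 8 // g p.1 p.2 = x} ≃ Fin 2)) := by
    refine (Equiv.subtypeEquivRight fun τ => ?_).trans
      (liftEquiv (fun p : Fin 2 × Fin 8 => g p.1 p.2))
    constructor
    · rintro rfl ⟨i, a⟩; rfl
    · intro h; funext i a; exact h (i, a)
  rw [Nat.card_congr e, Nat.card_eq_fintype_card, Fintype.card_pi]
  have : ∀ x, Fintype.card ({p : Fin 2 × Fin 8 // g p.1 p.2 = x} ≃ Fin 2) = 2 := by
    intro x
    rw [Fintype.card_equiv (Fintype.equivOfCardEq (by rw [hg x]; rfl)), hg x]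
    rfl
  simp [this]

theorem indeg_autOf (τ : Fin 2 × Fin 8 ≃ Fin 8 × Fin 2) : IndegA (autOf τ) := by
  intro z
  have := liftEquiv (fun p : Fin 2 × Fin 8 => autOf τ p.1 p.2) ⟨τ, fun p => rfl⟩ z
  rw [Fintype.card_congr this]
  rfl

theorem card_okA : Nat.card {g : Aut8 // OkA g} = 685440 := by
  rw [← NA_total]
  exact Nat.card_congr (Equiv.subtypeEquivRight fun g => ⟨fun h => ⟨h, trivial⟩, fun h => h.1⟩)

/-- Bijections with good automaton, sorted by their automaton. -/
def sortE : {τ : Fin 2 × Fin 8 ≃ Fin 8 × Fin 2 // GoodA (autOf τ)} ≃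
    Σ g : {g : Aut8 // OkA g}, {τ : Fin 2 × Fin 8 ≃ Fin 8 × Fin 2 // autOf τ = g.1} where
  toFun τ := ⟨⟨autOf τ.1, τ.2, indeg_autOf τ.1⟩, ⟨τ.1, rfl⟩⟩
  invFun q := ⟨q.2.1, by rw [q.2.2]; exact q.1.2.1⟩
  left_inv := by intro τ; rfl
  right_inv := by 
    rintro ⟨⟨g, hg⟩, ⟨τ, hτ⟩⟩
    change autOf τ = g at hτ
    subst hτ
    rfl

theorem card_bij_good :
    Nat.card {τ : Fin 2 × Fin 8 ≃ Fin 8 × Fin 2 // GoodA (autOf τ)} = 175472640 := by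
  classical
  rw [Nat.card_congr sortE, Nat.card_sigma,
    Finset.sum_congr rfl fun g _ => card_lifts g.1 g.2.2, Finset.sum_const, Finset.card_univ,
    ← Nat.card_eq_fintype_card, card_okA]
  rfl

/-- Words of length three. -/
noncomputable def wordEquiv : Fin 8 ≃ (Fin 3 → Fin 2) :=
  Fintype.equivOfCardEq (by simp)

/-- Words as pairs (first letter, rest). -/
noncomputable def consE : Fin 2 × Fin 8 ≃ (Fin (3 + 1) → Fin 2) where
  toFun q := Fin.cons q.1 (wordEquiv q.2)
  invFun w := (w 0, wordEquiv.symm (Fin.tail w))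
  left_inv := by rintro ⟨i, a⟩; simp
  right_inv := by intro w; simp

/-- Words as pairs (initial segment, last letter). -/
noncomputable def initE : (Fin (3 + 1) → Fin 2) ≃ Fin 8 × Fin 2 where
  toFun w := (wordEquiv.symm (Fin.init w), w (Fin.last 3))
  invFun q := Fin.snoc (α := fun _ => Fin 2) (wordEquiv q.1) q.2
  left_inv := by
    intro w
    simp only [Equiv.apply_symm_apply]
    exact Fin.snoc_init_self w
  right_inv := by
    rintro ⟨a, i⟩
    simp only [Fin.init_snoc, Fin.snoc_last, Equiv.symm_apply_apply]

/-- The bijection attached to a permutation. -/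
noncomputable def permE :
    Equiv.Perm (Fin (3 + 1) → Fin 2) ≃ (Fin 2 × Fin 8 ≃ Fin 8 × Fin 2) where
  toFun σ := (consE.trans σ.symm).trans initE
  invFun τ := ((consE.symm.trans τ).trans initE.symm).symm
  left_inv := by intro σ; ext w; simp
  right_inv := by intro τ; ext w <;> simp

theorem diagCond_iff (σ : Equiv.Perm (Fin (3 + 1) → Fin 2)) :
    diagCond σ ↔ GoodA (autOf (permE σ)) := by
  have hA : autOf (permE σ) = fun i a => wordEquiv.symm (fword σ i (wordEquiv a)) := rfl
  rw [hA]
  unfold GoodA diagCond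
  rw [Set.eq_univ_iff_forall]
  simp only [SigmaSet_conj, Set.mem_iUnion]
  constructor
  · intro h x y; exact h _
  · rintro h ⟨a, b⟩
    have := h (wordEquiv.symm a) (wordEquiv.symm b)
    simpa using this

theorem stmt_11 :
    Nat.card {σ : Equiv.Perm (Fin (3 + 1) → Fin 2) // diagCond σ} = 175472640 := by
  rw [← card_bij_good]
  exact Nat.card_congr (permE.subtypeEquiv diagCond_iff)
end

section
/- Among the permutations of the 9-element set W_3^2, exactly 576 satisfy both the diagonal condition and the annihilation condition. -/
/-- Contribution of two table entries to the diagonal graph (`κ e = i`) or to the annihilation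
graph (`κ e = m`).  An entry `e = 27 i + 9 a + 3 b + m` records `σ⁻¹(ia) = bm`; a pair of distinct
letters is encoded by the third letter. -/
def pK (κ : ℕ → ℕ) (e e' : ℕ) : ℕ :=
  bif Nat.beq (κ e) (κ e') && (!(Nat.beq (e / 9 % 3) (e' / 9 % 3)) &&
    !(Nat.beq (e / 3 % 3) (e' / 3 % 3))) then
    2 ^ (3 * (3 - e / 9 % 3 - e' / 9 % 3) + (3 - e / 3 % 3 - e' / 3 % 3)) else 0

def kD (e : ℕ) : ℕ := e / 27

def kA (e : ℕ) : ℕ := e % 3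

def stepM (p : ℕ → ℕ → ℕ) (e : ℕ) : List ℕ → ℕ
  | [] => 0
  | e' :: t => Nat.lor (p e e') (stepM p e t)

def maskM (p : ℕ → ℕ → ℕ) : List ℕ → ℕ
  | [] => 0
  | e :: t => Nat.lor (stepM p e t) (maskM p t)

def fresh (x : ℕ) : List ℕ → Bool
  | [] => true
  | e :: t => !(Nat.beq x (e % 9)) && fresh x t

/-- Acyclicity of the graph on `{0,1,2}` whose edges `c → d` are the bits `3c+d` of the mask. -/
def acyM (k : ℕ) : Bool :=
  Nat.beq (Nat.land k 273) 0 && (!(Nat.beq (Nat.land k 10) 10) && (!(Nat.beq (Nat.land k 68) 68) &&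
  (!(Nat.beq (Nat.land k 160) 160) && (!(Nat.beq (Nat.land k 98) 98) &&
   !(Nat.beq (Nat.land k 140) 140)))))

def okM (l : List ℕ) : Bool := acyM (maskM (pK kD) l) && acyM (maskM (pK kA) l)

def gen : ℕ → List (List ℕ)
  | 0 => [[]]
  | k + 1 => (gen k).flatMap fun acc =>
      ([0, 1, 2, 3, 4, 5, 6, 7, 8].filter fun x => fresh x acc && okM ((9 * k + x) :: acc)).map
        fun x => (9 * k + x) :: acc

theorem gen_length : (gen 9).length = 576 := by decide +kernel

theorem acyM_or : ∀ k < 512, acyM k = true ∨ (∃ c < 3, k.testBit (3 * c + c) = true) ∨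
    (∃ c < 3, ∃ d < 3, k.testBit (3 * c + d) = true ∧ k.testBit (3 * d + c) = true) ∨
    (∃ c < 3, ∃ d < 3, ∃ e < 3, k.testBit (3 * c + d) = true ∧ k.testBit (3 * d + e) = true ∧
      k.testBit (3 * e + c) = true) := by decide +kernel

theorem acyM_rank : ∀ k < 512, acyM k = true → ∃ r ∈ [[0, 1, 2], [0, 2, 1], [1, 0, 2], [1, 2, 0],
    [2, 0, 1], [2, 1, 0]], ∀ c < 3, ∀ d < 3, k.testBit (3 * c + d) = true →
      r.getD d 0 < r.getD c 0 := by decide +kernel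

theorem nbeq_false (a b : ℕ) : Nat.beq a b = false ↔ a ≠ b := by
  rw [← Bool.not_eq_true, Nat.beq_eq]

/-- The table of the first `k` values of `τ`. -/
def tab (τ : ℕ → ℕ) : ℕ → List ℕ
  | 0 => []
  | k + 1 => (9 * k + τ k) :: tab τ k

theorem pK_bit (κ : ℕ → ℕ) (e e' t : ℕ) : (pK κ e e').testBit t = true ↔
    κ e = κ e' ∧ e / 9 % 3 ≠ e' / 9 % 3 ∧ e / 3 % 3 ≠ e' / 3 % 3 ∧
      t = 3 * (3 - e / 9 % 3 - e' / 9 % 3) + (3 - e / 3 % 3 - e' / 3 % 3) := by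
  unfold pK
  by_cases h : (Nat.beq (κ e) (κ e') && (!(Nat.beq (e / 9 % 3) (e' / 9 % 3)) &&
    !(Nat.beq (e / 3 % 3) (e' / 3 % 3)))) = true
  · rw [h, cond_true, Nat.testBit_two_pow]
    simp only [Bool.and_eq_true, Bool.not_eq_true', Nat.beq_eq, nbeq_false] at h
    simp only [decide_eq_true_eq]
    constructor
    · intro ht; exact ⟨h.1, h.2.1, h.2.2, ht.symm⟩
    · intro ht; exact ht.2.2.2.symm
  · rw [Bool.not_eq_true] at h
    rw [h, cond_false]
    simp only [Nat.zero_testBit, Bool.false_eq_true, false_iff]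
    rintro ⟨h1, h2, h3, -⟩
    have : (Nat.beq (κ e) (κ e') && (!(Nat.beq (e / 9 % 3) (e' / 9 % 3)) &&
      !(Nat.beq (e / 3 % 3) (e' / 3 % 3)))) = true := by
      simp only [Bool.and_eq_true, Bool.not_eq_true', Nat.beq_eq, nbeq_false]
      exact ⟨h1, h2, h3⟩
    rw [h] at this
    exact absurd this (by decide)

theorem stepM_bit (p : ℕ → ℕ → ℕ) (τ : ℕ → ℕ) (e t k : ℕ) :
    (stepM p e (tab τ k)).testBit t = true ↔ ∃ q < k, (p e (9 * q + τ q)).testBit t = true := by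
  induction k with
  | zero => simp [tab, stepM]
  | succ k ih =>
    simp only [tab, stepM]
    change (p e (9 * k + τ k) ||| stepM p e (tab τ k)).testBit t = true ↔ _
    rw [Nat.testBit_or, Bool.or_eq_true, ih]
    constructor
    · rintro (h | ⟨q, hq, h⟩)
      · exact ⟨k, by omega, h⟩
      · exact ⟨q, by omega, h⟩
    · rintro ⟨q, hq, h⟩
      rcases Nat.lt_succ_iff_lt_or_eq.mp hq with h' | rfl
      · exact Or.inr ⟨q, h', h⟩
      · exact Or.inl h

theorem maskM_bit (p : ℕ → ℕ → ℕ) (τ : ℕ → ℕ) (t k : ℕ) :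
    (maskM p (tab τ k)).testBit t = true ↔
      ∃ q < k, ∃ q' < q, (p (9 * q + τ q) (9 * q' + τ q')).testBit t = true := by
  induction k with
  | zero => simp [tab, maskM]
  | succ k ih =>
    simp only [tab, maskM]
    change (stepM p (9 * k + τ k) (tab τ k) ||| maskM p (tab τ k)).testBit t = true ↔ _
    rw [Nat.testBit_or, Bool.or_eq_true, ih, stepM_bit]
    constructor
    · rintro (h | ⟨q, hq, h⟩)
      · exact ⟨k, by omega, h⟩
      · exact ⟨q, by omega, h⟩
    · rintro ⟨q, hq, h⟩
      rcases Nat.lt_succ_iff_lt_or_eq.mp hq with h' | rfl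
      · exact Or.inr ⟨q, h', h⟩
      · exact Or.inl h

/-- The transition relation on pairs of letters. -/
def RK (κ : ℕ → ℕ) (τ : ℕ → ℕ) (a b a' b' : ℕ) : Prop :=
  ∃ q < 9, ∃ q' < 9, q % 3 = a ∧ q' % 3 = b ∧ τ q / 3 = a' ∧ τ q' / 3 = b' ∧
    κ (9 * q + τ q) = κ (9 * q' + τ q')

/-- Existence of a rank function on unordered pairs decreasing along transitions. -/
def Ranked (R : ℕ → ℕ → ℕ → ℕ → Prop) : Prop :=
  ∃ r : ℕ → ℕ, ∀ a < 3, ∀ b < 3, ∀ a' < 3, ∀ b' < 3, a ≠ b → a' ≠ b' → R a b a' b' →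
    r (3 - a' - b') < r (3 - a - b)

theorem mask_lt (κ τ : ℕ → ℕ) (k : ℕ) : maskM (pK κ) (tab τ k) < 512 := by
  have : maskM (pK κ) (tab τ k) < 2 ^ 9 := by
    apply Nat.lt_pow_two_of_testBit
    intro i hi
    by_contra h
    rw [Bool.not_eq_false, maskM_bit] at h
    obtain ⟨q, _, q', _, h⟩ := h
    rw [pK_bit] at h
    omega
  simpa using this

theorem ranked_iff (κ τ : ℕ → ℕ) (hτ : ∀ q < 9, τ q < 9) :
    Ranked (RK κ τ) ↔ ∀ k ≤ 9, acyM (maskM (pK κ) (tab τ k)) = true := by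
  constructor
  · rintro ⟨r, hr⟩ k hk
    have key : ∀ c < 3, ∀ d < 3, (maskM (pK κ) (tab τ k)).testBit (3 * c + d) = true →
        r d < r c := by
      intro c hc d hd h
      rw [maskM_bit] at h
      obtain ⟨q, hq, q', hq', h⟩ := h
      rw [pK_bit] at h
      obtain ⟨h1, h2, h3, h4⟩ := h
      have t1 := hτ q (by omega)
      have t2 := hτ q' (by omega)
      have := hr (q % 3) (by omega) (q' % 3) (by omega) (τ q / 3) (by omega) (τ q' / 3) (by omega)
        (by omega) (by omega) ⟨q, by omega, q', by omega, rfl, rfl, rfl, rfl, h1⟩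
      have e1 : 3 - τ q / 3 - τ q' / 3 = d := by omega
      have e2 : 3 - q % 3 - q' % 3 = c := by omega
      rwa [e1, e2] at this
    rcases acyM_or _ (mask_lt κ τ k) with h | ⟨c, hc, h⟩ | ⟨c, hc, d, hd, h, h'⟩ |
      ⟨c, hc, d, hd, e, he, h, h', h''⟩
    · exact h
    · exact absurd (key c hc c hc h) (lt_irrefl _)
    · have := key c hc d hd h
      have := key d hd c hc h'
      omega
    · have := key c hc d hd h
      have := key d hd e he h'
      have := key e he c hc h''
      omega
  · intro h
    obtain ⟨r, -, hr⟩ := acyM_rank _ (mask_lt κ τ 9) (h 9 le_rfl)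
    refine ⟨fun c => r.getD c 0, ?_⟩
    rintro a ha b hb a' ha' b' hb' hab hab' ⟨q, hq, q', hq', rfl, rfl, rfl, rfl, hk⟩
    apply hr _ (by omega) _ (by omega)
    rw [maskM_bit]
    have t1 := hτ q hq
    have t2 := hτ q' hq'
    have hne : q ≠ q' := by rintro rfl; exact hab rfl
    rcases Nat.lt_or_gt_of_ne hne with hlt | hlt
    · refine ⟨q', hq', q, hlt, ?_⟩
      rw [pK_bit]
      exact ⟨hk.symm, by omega, by omega, by omega⟩
    · refine ⟨q, hq, q', hlt, ?_⟩
      rw [pK_bit]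
      exact ⟨hk, by omega, by omega, by omega⟩

theorem fresh_tab (τ : ℕ → ℕ) (x k : ℕ) (hk : ∀ q < k, τ q < 9) :
    fresh x (tab τ k) = true ↔ ∀ q < k, x ≠ τ q := by
  induction k with
  | zero => simp [tab, fresh]
  | succ k ih =>
    simp only [tab, fresh, Bool.and_eq_true, Bool.not_eq_true', nbeq_false]
    rw [ih (fun q hq => hk q (by omega))]
    have h9 := hk k (by omega)
    have : (9 * k + τ k) % 9 = τ k := by omega
    rw [this]
    constructor
    · rintro ⟨h1, h2⟩ q hq
      rcases Nat.lt_succ_iff_lt_or_eq.mp hq with h' | rfl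
      · exact h2 q h'
      · exact h1
    · intro h
      exact ⟨h k (by omega), fun q hq => h q (by omega)⟩

theorem tab_congr (τ τ' : ℕ → ℕ) (k : ℕ) (h : ∀ q < k, τ q = τ' q) : tab τ k = tab τ' k := by
  induction k with
  | zero => rfl
  | succ k ih => simp only [tab]; rw [h k (by omega), ih (fun q hq => h q (by omega))]

theorem tab_inj (τ τ' : ℕ → ℕ) (k : ℕ) (h : tab τ k = tab τ' k) : ∀ q < k, τ q = τ' q := by
  induction k with
  | zero => intro q hq; omega
  | succ k ih =>
    simp only [tab, List.cons.injEq] at h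
    intro q hq
    rcases Nat.lt_succ_iff_lt_or_eq.mp hq with h' | rfl
    · exact ih h.2 q h'
    · omega

theorem mem_nine (x : ℕ) : x ∈ [0, 1, 2, 3, 4, 5, 6, 7, 8] ↔ x < 9 := by
  simp only [List.mem_cons, List.not_mem_nil, or_false]
  omega

theorem mem_gen (k : ℕ) (l : List ℕ) : l ∈ gen k ↔ ∃ τ : ℕ → ℕ, l = tab τ k ∧
    (∀ q < k, τ q < 9) ∧ (∀ q < k, ∀ q' < q, τ q ≠ τ q') ∧
      ∀ j ≤ k, okM (tab τ j) = true := by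
  induction k generalizing l with
  | zero =>
    simp only [gen, List.mem_singleton]
    constructor
    · rintro rfl
      refine ⟨id, rfl, by omega, by omega, ?_⟩
      intro j hj
      obtain rfl : j = 0 := by omega
      decide
    · rintro ⟨τ, rfl, -⟩; rfl
  | succ k ih =>
    simp only [gen, List.mem_flatMap, List.mem_map, List.mem_filter, mem_nine, Bool.and_eq_true]
    constructor
    · rintro ⟨acc, hacc, x, ⟨hx, hf, hok⟩, rfl⟩
      obtain ⟨τ, rfl, h1, h2, h3⟩ := (ih acc).mp hacc
      have hu : ∀ q < k, Function.update τ k x q = τ q := fun q hq =>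
        Function.update_of_ne (by omega) _ _
      have ht : ∀ j ≤ k, tab (Function.update τ k x) j = tab τ j := fun j hj =>
        tab_congr _ _ _ fun q hq => hu q (by omega)
      have hk : tab (Function.update τ k x) (k + 1) = (9 * k + x) :: tab τ k := by
        simp only [tab]
        rw [ht k le_rfl, Function.update_self]
      rw [fresh_tab _ _ _ h1] at hf
      refine ⟨Function.update τ k x, hk.symm, ?_, ?_, ?_⟩
      · intro q hq
        rcases Nat.lt_succ_iff_lt_or_eq.mp hq with h' | rfl
        · rw [hu q h']; exact h1 q h'
        · rw [Function.update_self]; exact hx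
      · intro q hq q' hq'
        rw [hu q' (by omega)]
        rcases Nat.lt_succ_iff_lt_or_eq.mp hq with h' | rfl
        · rw [hu q h']; exact h2 q h' q' hq'
        · rw [Function.update_self]; exact hf q' hq'
      · intro j hj
        rcases Nat.le_succ_iff.mp hj with h' | rfl
        · rw [ht j h']; exact h3 j h'
        · rw [hk]; exact hok
    · rintro ⟨τ, rfl, h1, h2, h3⟩
      refine ⟨tab τ k, (ih _).mpr ⟨τ, rfl, fun q hq => h1 q (by omega),
        fun q hq => h2 q (by omega), fun j hj => h3 j (by omega)⟩, τ k,
        ⟨h1 k (by omega), ?_, h3 (k + 1) le_rfl⟩, rfl⟩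
      rw [fresh_tab _ _ _ fun q hq => h1 q (by omega)]
      exact fun q hq => h2 k (by omega) q hq

theorem gen_nodup (k : ℕ) : (gen k).Nodup := by
  induction k with
  | zero => simp [gen]
  | succ k ih =>
    simp only [gen]
    rw [List.nodup_flatMap]
    constructor
    · intro acc _
      apply List.Nodup.map
      · intro x y h
        simp only [List.cons.injEq, and_true] at h
        omega
      · exact List.Nodup.filter _ (by decide)
    · refine ih.imp ?_
      intro a b hab l hl hl'
      simp only [List.mem_map] at hl hl'
      obtain ⟨x, -, rfl⟩ := hl
      obtain ⟨y, -, hy⟩ := hl'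
      simp only [List.cons.injEq] at hy
      exact hab hy.2.symm

/-- Rank characterization of an inductively generated relation. -/
theorem exhaust_iff (S : ℕ → Fin 3 → Fin 3 → Prop) (R : ℕ → ℕ → ℕ → ℕ → Prop)
    (hsym : ∀ a b a' b', R a b a' b' → R b a b' a')
    (h0 : ∀ a b, S 0 a b ↔ a = b)
    (hs : ∀ m a b, S (m + 1) a b ↔
      S m a b ∨ ∀ a' b' : Fin 3, R a b a' b' → S m a' b') :
    (∀ a b, ∃ m, S m a b) ↔ Ranked R := by
  classical
  have hd : ∀ m a, S m a a := by
    intro m a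
    induction m with
    | zero => exact (h0 a a).mpr rfl
    | succ m ih => exact (hs m a a).mpr (Or.inl ih)
  constructor
  · intro h
    have hS : ∀ m a b, S m a b → S m b a := by
      intro m
      induction m with
      | zero => intro a b hab; rw [h0] at *; exact hab.symm
      | succ m ih =>
        intro a b hab
        rw [hs] at *
        rcases hab with hab | hab
        · exact Or.inl (ih _ _ hab)
        · exact Or.inr fun a' b' hR => ih _ _ (hab b' a' (hsym _ _ _ _ hR))
    let rk : Fin 3 → Fin 3 → ℕ := fun a b => Nat.find (h a b)
    have hrk : ∀ a b, rk a b = rk b a := by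
      intro a b
      apply le_antisymm
      · exact Nat.find_min' _ (hS _ _ _ (Nat.find_spec (h b a)))
      · exact Nat.find_min' _ (hS _ _ _ (Nat.find_spec (h a b)))
    have hdec : ∀ a b a' b' : Fin 3, a ≠ b → R a b a' b' → rk a' b' < rk a b := by
      intro a b a' b' hab hR
      have hsp : S (rk a b) a b := Nat.find_spec (h a b)
      have hmin : ∀ m < rk a b, ¬ S m a b := fun m hm => Nat.find_min (h a b) hm
      generalize rk a b = n at *
      cases n with
      | zero => exact absurd ((h0 a b).mp hsp) hab
      | succ m =>
        rw [hs] at hsp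
        rcases hsp with hsp | hsp
        · exact absurd hsp (hmin m (by omega))
        · have := hsp a' b' hR
          exact Nat.lt_succ_of_le (Nat.find_min' (h a' b') this)
    let r : ℕ → ℕ := fun c => if c = 0 then rk 1 2 else if c = 1 then rk 0 2 else rk 0 1
    have hr : ∀ a b : Fin 3, a ≠ b → r (3 - a - b) = rk a b := by
      intro a b hab
      fin_cases a <;> fin_cases b <;> first | exact absurd rfl hab | rfl | exact hrk _ _
    refine ⟨r, ?_⟩
    intro a ha b hb a' ha' b' hb' hab hab' hR
    have e1 := hr ⟨a, ha⟩ ⟨b, hb⟩ (by simpa using hab)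
    have e2 := hr ⟨a', ha'⟩ ⟨b', hb'⟩ (by simpa using hab')
    simp only at e1 e2
    rw [e1, e2]
    exact hdec _ _ _ _ (by simpa using hab) hR
  · rintro ⟨r, hr⟩
    have key : ∀ n (a b : Fin 3), r (3 - a - b) < n → S n a b := by
      intro n
      induction n with
      | zero => intro a b h; omega
      | succ n ih =>
        intro a b h
        by_cases hab : a = b
        · subst hab; exact hd _ _
        · rw [hs]
          right
          intro a' b' hR
          by_cases hab' : a' = b'
          · subst hab'; exact hd _ _
          · apply ih
            have := hr a a.2 b b.2 a' a'.2 b' b'.2 (fun e => hab (Fin.ext e))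
              (fun e => hab' (Fin.ext e)) hR
            omega
    exact fun a b => ⟨_, key _ a b (Nat.lt_succ_self _)⟩

/-- The inverse of a permutation as a numerical function. -/
def tau (σ : Equiv.Perm (Fin (1 + 1) → Fin 3)) (q : ℕ) : ℕ :=
  3 * (σ.symm (Fin.cons (Fin.ofNat 3 (q / 3)) fun _ => Fin.ofNat 3 (q % 3)) 0 : ℕ) +
    (σ.symm (Fin.cons (Fin.ofNat 3 (q / 3)) fun _ => Fin.ofNat 3 (q % 3)) (Fin.last 1) : ℕ)

theorem tau_lt (σ : Equiv.Perm (Fin (1 + 1) → Fin 3)) (q : ℕ) : tau σ q < 9 := by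
  unfold tau; omega

theorem word_eq (w : Fin 1 → Fin 3) : (fun _ => w 0) = w := by
  funext i; rw [Subsingleton.elim i 0]

theorem tau_eq (σ : Equiv.Perm (Fin (1 + 1) → Fin 3)) (i a : Fin 3) :
    tau σ (3 * i + a) / 3 = (σ.symm (Fin.cons i fun _ => a) 0 : ℕ) ∧
    tau σ (3 * i + a) % 3 = (σ.symm (Fin.cons i fun _ => a) (Fin.last 1) : ℕ) := by
  have h1 : Fin.ofNat 3 ((3 * (i : ℕ) + a) / 3) = i := by
    apply Fin.ext; simp only [Fin.val_ofNat]; omega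
  have h2 : Fin.ofNat 3 ((3 * (i : ℕ) + a) % 3) = a := by
    apply Fin.ext; simp only [Fin.val_ofNat]; omega
  unfold tau
  rw [h1, h2]
  omega

theorem RK_symm (κ τ : ℕ → ℕ) (a b a' b' : ℕ) (h : RK κ τ a b a' b') : RK κ τ b a b' a' := by
  obtain ⟨q, hq, q', hq', h1, h2, h3, h4, h5⟩ := h
  exact ⟨q', hq', q, hq, h2, h1, h4, h3, h5.symm⟩

theorem RK_D (σ : Equiv.Perm (Fin (1 + 1) → Fin 3)) (a b a' b' : Fin 3) :
    RK kD (tau σ) a b a' b' ↔ ∃ i : Fin 3, σ.symm (Fin.cons i fun _ => a) 0 = a' ∧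
      σ.symm (Fin.cons i fun _ => b) 0 = b' := by
  constructor
  · rintro ⟨q, hq, q', hq', h1, h2, h3, h4, h5⟩
    unfold kD at h5
    have t1 := tau_lt σ q
    have t2 := tau_lt σ q'
    have e1 : q = 3 * (⟨q / 3, by omega⟩ : Fin 3) + a := by simp only; omega
    have e2 : q' = 3 * (⟨q / 3, by omega⟩ : Fin 3) + b := by simp only; omega
    refine ⟨⟨q / 3, by omega⟩, Fin.ext ?_, Fin.ext ?_⟩
    · rw [← (tau_eq σ _ a).1, ← e1, h3]
    · rw [← (tau_eq σ _ b).1, ← e2, h4]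
  · rintro ⟨i, h1, h2⟩
    have t1 := tau_lt σ (3 * i + a)
    have t2 := tau_lt σ (3 * i + b)
    refine ⟨3 * i + a, by omega, 3 * i + b, by omega, by omega, by omega, ?_, ?_, ?_⟩
    · rw [(tau_eq σ i a).1, h1]
    · rw [(tau_eq σ i b).1, h2]
    · unfold kD; omega

theorem RK_A (σ : Equiv.Perm (Fin (1 + 1) → Fin 3)) (a b a' b' : Fin 3) :
    RK kA (tau σ) a b a' b' ↔ ∃ i j : Fin 3, σ.symm (Fin.cons i fun _ => a) 0 = a' ∧
      σ.symm (Fin.cons j fun _ => b) 0 = b' ∧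
      σ.symm (Fin.cons i fun _ => a) (Fin.last 1) = σ.symm (Fin.cons j fun _ => b) (Fin.last 1) := by
  constructor
  · rintro ⟨q, hq, q', hq', h1, h2, h3, h4, h5⟩
    unfold kA at h5
    have t1 := tau_lt σ q
    have t2 := tau_lt σ q'
    have e1 : q = 3 * (⟨q / 3, by omega⟩ : Fin 3) + a := by simp only; omega
    have e2 : q' = 3 * (⟨q' / 3, by omega⟩ : Fin 3) + b := by simp only; omega
    refine ⟨⟨q / 3, by omega⟩, ⟨q' / 3, by omega⟩, Fin.ext ?_, Fin.ext ?_, Fin.ext ?_⟩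
    · rw [← (tau_eq σ _ a).1, ← e1, h3]
    · rw [← (tau_eq σ _ b).1, ← e2, h4]
    · rw [← (tau_eq σ _ a).2, ← (tau_eq σ _ b).2, ← e1, ← e2]; omega
  · rintro ⟨i, j, h1, h2, h3⟩
    have t1 := tau_lt σ (3 * i + a)
    have t2 := tau_lt σ (3 * j + b)
    have u1 := (tau_eq σ i a).2
    have u2 := (tau_eq σ j b).2
    rw [h3, ← u2] at u1
    refine ⟨3 * i + a, by omega, 3 * j + b, by omega, by omega, by omega, ?_, ?_, ?_⟩
    · rw [(tau_eq σ i a).1, h1]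
    · rw [(tau_eq σ j b).1, h2]
    · unfold kA; omega

theorem init_eq (w : Fin (1 + 1) → Fin 3) : (Fin.init w : Fin 1 → Fin 3) = fun _ => w 0 := by
  funext i; rw [Subsingleton.elim i 0]; rfl

theorem diag_iff (σ : Equiv.Perm (Fin (1 + 1) → Fin 3)) :
    diagCond σ ↔ Ranked (RK kD (tau σ)) := by
  rw [← exhaust_iff (fun m a b => ((fun _ => a, fun _ => b) :
    (Fin 1 → Fin 3) × (Fin 1 → Fin 3)) ∈ SigmaSet (fword σ) m) _ (RK_symm kD _)]
  · unfold diagCond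
    rw [Set.eq_univ_iff_forall]
    simp only [Set.mem_iUnion]
    constructor
    · intro h a b; exact h _
    · rintro h ⟨α, β⟩
      have := h (α 0) (β 0)
      rwa [word_eq, word_eq] at this
  · intro a b
    simp only [SigmaSet, Set.mem_ofPred_eq]
    constructor
    · intro h; exact congrFun h 0
    · rintro rfl; rfl
  · intro m a b
    simp only [SigmaSet, Set.mem_union, Set.mem_ofPred_eq, RK_D, fword, init_eq]
    apply or_congr_right
    constructor
    · rintro h a' b' ⟨i, rfl, rfl⟩; exact h i
    · intro h i; exact h _ _ ⟨i, rfl, rfl⟩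

theorem psi_mono {Y ι : Type*} (dag : Y) (g : ι → Y → Y) (m : ℕ) :
    PsiSet dag g m ⊆ PsiSet dag g (m + 1) := by
  induction m with
  | zero => intro y hy; exact Or.inl hy
  | succ m ih =>
    rintro y (hy | hy)
    · exact Or.inl hy
    · exact Or.inr fun j => ih (hy j)

theorem psi_dag {Y ι : Type*} (dag : Y) (g : ι → Y → Y) (m : ℕ) : dag ∈ PsiSet dag g m := by
  cases m with
  | zero => exact rfl
  | succ m => exact Or.inl rfl

/-- An off-diagonal pair as a point of `𝒲`. -/
def mkP (α β : Fin 1 → Fin 3) (h : α ≠ β) : OffDiag 3 1 := some ⟨(α, β), h⟩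

theorem fpair_pos (σ : Equiv.Perm (Fin (1 + 1) → Fin 3)) (i j : Fin 3) (α β : Fin 1 → Fin 3)
    (h : α ≠ β)
    (hm : (σ.symm (Fin.cons i α)) (Fin.last 1) = (σ.symm (Fin.cons j β)) (Fin.last 1))
    (hn : (fun _ => σ.symm (Fin.cons i α) 0 : Fin 1 → Fin 3) ≠
      fun _ => σ.symm (Fin.cons j β) 0) :
    fpair σ i j (mkP α β h) = mkP _ _ hn := by
  have hn' : Fin.init (σ.symm (Fin.cons i α)) ≠ Fin.init (σ.symm (Fin.cons j β)) := by
    rw [init_eq, init_eq]; exact hn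
  have e : fpair σ i j (mkP α β h) = mkP _ _ hn' := dif_pos ⟨hm, hn'⟩
  rw [e]
  congr 1 <;> exact init_eq _

theorem fpair_neg (σ : Equiv.Perm (Fin (1 + 1) → Fin 3)) (i j : Fin 3) (α β : Fin 1 → Fin 3)
    (h : α ≠ β)
    (hn : ¬ ((σ.symm (Fin.cons i α)) (Fin.last 1) = (σ.symm (Fin.cons j β)) (Fin.last 1) ∧
      (fun _ => σ.symm (Fin.cons i α) 0 : Fin 1 → Fin 3) ≠ fun _ => σ.symm (Fin.cons j β) 0)) :
    fpair σ i j (mkP α β h) = none := by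
  rw [← init_eq, ← init_eq] at hn
  exact dif_neg hn

theorem ann_iff (σ : Equiv.Perm (Fin (1 + 1) → Fin 3)) :
    annCond σ ↔ Ranked (RK kA (tau σ)) := by
  rw [← exhaust_iff (fun m a b => ∀ h : (fun _ => a : Fin 1 → Fin 3) ≠ fun _ => b,
    mkP (fun _ => a) (fun _ => b) h ∈ PsiSet (none : OffDiag 3 1) (fun ij : Fin 3 × Fin 3 => fpair σ ij.1 ij.2) m) _
    (RK_symm kA _)]
  · unfold annCond
    rw [Set.eq_univ_iff_forall]
    simp only [Set.mem_iUnion]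
    constructor
    · intro h a b
      by_cases hab : (fun _ => a : Fin 1 → Fin 3) ≠ fun _ => b
      · obtain ⟨m, hm⟩ := h (some ⟨(fun _ => a, fun _ => b), hab⟩)
        exact ⟨m, fun _ => hm⟩
      · exact ⟨0, fun h => absurd h hab⟩
    · rintro h (_ | ⟨⟨α, β⟩, hab⟩)
      · exact ⟨0, rfl⟩
      · obtain ⟨m, hm⟩ := h (α 0) (β 0)
        rw [word_eq, word_eq] at hm
        exact ⟨m, hm hab⟩
  · intro a b
    constructor
    · intro h
      by_contra hab
      have := h fun e => hab (congrFun e 0)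
      simp only [PsiSet] at this
      exact Option.some_ne_none _ this
    · rintro rfl h; exact absurd rfl h
  · intro m a b
    simp only [RK_A]
    constructor
    · intro h
      by_cases hab : (fun _ => a : Fin 1 → Fin 3) ≠ fun _ => b
      · right
        rintro a' b' ⟨i, j, rfl, rfl, hm⟩ hne
        rcases h hab with h | h
        · exact absurd h (Option.some_ne_none _)
        · have h : fpair σ i j (mkP _ _ hab) ∈ _ := h (i, j)
          rwa [fpair_pos σ i j _ _ hab hm hne] at h
      · exact Or.inl fun h => absurd h hab
    · rintro (h | h) hab
      · exact psi_mono _ _ _ (h hab)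
      · right
        rintro ⟨i, j⟩
        change fpair σ i j (mkP _ _ hab) ∈ _
        by_cases hc : (σ.symm (Fin.cons i fun _ => a)) (Fin.last 1) =
            (σ.symm (Fin.cons j fun _ => b)) (Fin.last 1) ∧
            (fun _ => σ.symm (Fin.cons i fun _ => a) 0 : Fin 1 → Fin 3) ≠
              fun _ => σ.symm (Fin.cons j fun _ => b) 0
        · rw [fpair_pos σ i j _ _ hab hc.1 hc.2]
          exact h _ _ ⟨i, j, rfl, rfl, hc.1⟩ hc.2
        · rw [fpair_neg σ i j _ _ hab hc]
          exact psi_dag _ _ _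

theorem good_iff (σ : Equiv.Perm (Fin (1 + 1) → Fin 3)) :
    diagCond σ ∧ annCond σ ↔ ∀ k ≤ 9, okM (tab (tau σ) k) = true := by
  rw [diag_iff, ann_iff, ranked_iff _ _ fun q _ => tau_lt σ q, ranked_iff _ _ fun q _ => tau_lt σ q]
  simp only [okM, Bool.and_eq_true]
  constructor
  · rintro ⟨h1, h2⟩ k hk; exact ⟨h1 k hk, h2 k hk⟩
  · intro h; exact ⟨fun k hk => (h k hk).1, fun k hk => (h k hk).2⟩

theorem two_ext (w w' : Fin (1 + 1) → Fin 3) (h0 : w 0 = w' 0)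
    (h1 : w (Fin.last 1) = w' (Fin.last 1)) : w = w' := by
  funext i
  fin_cases i
  · exact h0
  · exact h1

theorem cons_eta (w : Fin (1 + 1) → Fin 3) :
    (Fin.cons (w 0) (fun _ => w (Fin.last 1)) : Fin (1 + 1) → Fin 3) = w :=
  two_ext _ _ rfl rfl

theorem tau_word (σ : Equiv.Perm (Fin (1 + 1) → Fin 3)) (w : Fin (1 + 1) → Fin 3) :
    tau σ (3 * (w 0 : ℕ) + (w (Fin.last 1) : ℕ)) / 3 = (σ.symm w 0 : ℕ) ∧
    tau σ (3 * (w 0 : ℕ) + (w (Fin.last 1) : ℕ)) % 3 = (σ.symm w (Fin.last 1) : ℕ) := by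
  have := tau_eq σ (w 0) (w (Fin.last 1))
  rwa [cons_eta] at this

theorem tau_inj (σ : Equiv.Perm (Fin (1 + 1) → Fin 3)) (q q' : ℕ) (hq : q < 9) (hq' : q' < 9)
    (h : tau σ q = tau σ q') : q = q' := by
  let w : ℕ → Fin (1 + 1) → Fin 3 := fun q =>
    Fin.cons (Fin.ofNat 3 (q / 3)) fun _ => Fin.ofNat 3 (q % 3)
  have hw : ∀ q, tau σ q = 3 * (σ.symm (w q) 0 : ℕ) + (σ.symm (w q) (Fin.last 1) : ℕ) :=
    fun q => rfl
  rw [hw, hw] at h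
  have : w q = w q' := by
    apply σ.symm.injective
    apply two_ext
    · apply Fin.ext; omega
    · apply Fin.ext; omega
  have e0 : q / 3 % 3 = q' / 3 % 3 := congrArg Fin.val (congrFun this 0)
  have e1 : q % 3 % 3 = q' % 3 % 3 := congrArg Fin.val (congrFun this (Fin.last 1))
  omega

theorem tau_ext (σ σ' : Equiv.Perm (Fin (1 + 1) → Fin 3)) (h : ∀ q < 9, tau σ q = tau σ' q) :
    σ = σ' := by
  have : σ.symm = σ'.symm := by
    ext1 w
    have h1 := tau_word σ w
    have h2 := tau_word σ' w
    rw [h _ (by omega)] at h1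
    apply two_ext
    · apply Fin.ext; rw [← h1.1, ← h2.1]
    · apply Fin.ext; rw [← h1.2, ← h2.2]
  exact Equiv.symm_bijective.injective this

theorem exists_tau (τ : ℕ → ℕ) (h9 : ∀ q < 9, τ q < 9) (hinj : ∀ q < 9, ∀ q' < q, τ q ≠ τ q') :
    ∃ σ : Equiv.Perm (Fin (1 + 1) → Fin 3), ∀ q < 9, tau σ q = τ q := by
  let g : (Fin (1 + 1) → Fin 3) → (Fin (1 + 1) → Fin 3) := fun w =>
    Fin.cons (Fin.ofNat 3 (τ (3 * (w 0 : ℕ) + (w (Fin.last 1) : ℕ)) / 3)) fun _ =>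
      Fin.ofNat 3 (τ (3 * (w 0 : ℕ) + (w (Fin.last 1) : ℕ)) % 3)
  have g0 : ∀ w, (g w 0 : ℕ) = τ (3 * (w 0 : ℕ) + (w (Fin.last 1) : ℕ)) / 3 % 3 := fun w => rfl
  have g1 : ∀ w, (g w (Fin.last 1) : ℕ) = τ (3 * (w 0 : ℕ) + (w (Fin.last 1) : ℕ)) % 3 % 3 :=
    fun w => rfl
  have hg : Function.Injective g := by
    intro w w' h
    have e0 := g0 w
    have e1 := g1 w
    rw [h, g0] at e0
    rw [h, g1] at e1
    have b1 := h9 (3 * (w 0 : ℕ) + (w (Fin.last 1) : ℕ)) (by omega)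
    have b2 := h9 (3 * (w' 0 : ℕ) + (w' (Fin.last 1) : ℕ)) (by omega)
    have hq : 3 * (w 0 : ℕ) + (w (Fin.last 1) : ℕ) = 3 * (w' 0 : ℕ) + (w' (Fin.last 1) : ℕ) := by
      by_contra hne
      rcases Nat.lt_or_gt_of_ne hne with hlt | hlt
      · exact hinj _ (by omega) _ hlt (by omega)
      · exact hinj _ (by omega) _ hlt (by omega)
    apply two_ext
    · apply Fin.ext; omega
    · apply Fin.ext; omega
  refine ⟨(Equiv.ofBijective g (Finite.injective_iff_bijective.mp hg)).symm, fun q hq => ?_⟩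
  have b := h9 q hq
  let w : Fin (1 + 1) → Fin 3 := Fin.cons (Fin.ofNat 3 (q / 3)) fun _ => Fin.ofNat 3 (q % 3)
  have w0 : (w 0 : ℕ) = q / 3 % 3 := rfl
  have w1 : (w (Fin.last 1) : ℕ) = q % 3 % 3 := rfl
  have hwq : 3 * (w 0 : ℕ) + (w (Fin.last 1) : ℕ) = q := by omega
  change 3 * (g w 0 : ℕ) + (g w (Fin.last 1) : ℕ) = τ q
  rw [g0, g1, hwq]
  omega

theorem stmt_15 :
    Nat.card {σ : Equiv.Perm (Fin (1 + 1) → Fin 3) // diagCond σ ∧ annCond σ} = 576 := by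
  let Φ : {σ : Equiv.Perm (Fin (1 + 1) → Fin 3) // diagCond σ ∧ annCond σ} → List ℕ :=
    fun s => tab (tau s.1) 9
  have hΦ : Function.Injective Φ := by
    intro s s' h
    exact Subtype.ext (tau_ext _ _ (tab_inj _ _ _ h))
  have hr : Set.range Φ = ((gen 9).toFinset : Set (List ℕ)) := by
    ext l
    simp only [Set.mem_range, List.coe_toFinset, Set.mem_ofPred_eq, mem_gen]
    constructor
    · rintro ⟨s, rfl⟩
      refine ⟨tau s.1, rfl, fun q _ => tau_lt _ q, ?_, (good_iff _).mp s.2⟩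
      intro q hq q' hq' h
      have := tau_inj _ _ _ hq (by omega) h
      omega
    · rintro ⟨τ, rfl, h1, h2, h3⟩
      obtain ⟨σ, hσ⟩ := exists_tau τ h1 h2
      refine ⟨⟨σ, (good_iff σ).mpr fun k hk => ?_⟩, tab_congr _ _ _ hσ⟩
      rw [tab_congr _ τ k fun q hq => hσ q (by omega)]
      exact h3 k hk
  rw [Nat.card_congr (Equiv.ofInjective Φ hΦ), Nat.card_coe_set_eq, hr, Set.ncard_coe_finset,
    List.toFinset_card_of_nodup (gen_nodup 9), gen_length]
end
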